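/- arXiv:1312.3955 — 8 statements merged into one kernel-verified Lean document; each statement's English description precedes it below -/
import Mathlib

section
/- For every n ≥ 1, the second central moment of the number of occurrences of the pattern 123 in a uniformly random permutation of S_n satisfies (1/n!)·∑_{π ∈ S_n} (N_{123}(π) − binom(n,3)/6)² = n(n−1)(n−2)(39n² + 102n − 157)/21600. -/
/-- The number of occurrences of the pattern `σ ∈ S_k` in the permutation `π ∈ S_n`. -/
def occ {k n : ℕ} (σ : Equiv.Perm (Fin k)) (π : Equiv.Perm (Fin n)) : ℕ :=
  (Finset.univ.filter (fun f : Fin k → Fin n =>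
    (∀ a b : Fin k, a < b → f a < f b) ∧
    (∀ a b : Fin k, π (f a) < π (f b) ↔ σ a < σ b))).card

/-- The pattern 123 (one-line notation), i.e. the identity of `S_3`. -/
def p123 : Equiv.Perm (Fin 3) := 1

/-- The pattern 132 (one-line notation). -/
def p132 : Equiv.Perm (Fin 3) := Equiv.swap 1 2

/-- The pattern 312 (one-line notation): 1 ↦ 3, 2 ↦ 1, 3 ↦ 2. -/
def p312 : Equiv.Perm (Fin 3) := ⟨![2, 0, 1], ![1, 2, 0], by decide, by decide⟩

/-- The pattern 321 (one-line notation). -/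
def p321 : Equiv.Perm (Fin 3) := Equiv.swap 0 2

open Finset in
/-- The relative order of the values of a uniformly random permutation of `Fin n` at `m` given
positions is that of a uniformly random permutation of `Fin m`. -/
theorem factorial_mul_sum_perm_comp_orderEmbedding {m n : ℕ} (e : Fin m ↪o Fin n)
    (Φ : (Fin m → Fin m → Prop) → ℚ) :
    (m.factorial : ℚ) * ∑ π : Equiv.Perm (Fin n), Φ (fun a b => π (e a) < π (e b))
      = (n.factorial : ℚ) * ∑ τ : Equiv.Perm (Fin m), Φ (fun a b => τ a < τ b) := by
  have shift (ρ : Equiv.Perm (Fin m)) :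
      ∑ π : Equiv.Perm (Fin n), Φ (fun a b => π (e a) < π (e b))
        = ∑ π : Equiv.Perm (Fin n), Φ (fun a b => π (e (ρ a)) < π (e (ρ b))) := by
    rw [← Equiv.sum_comp (Equiv.mulRight (ρ.viaFintypeEmbedding e.toEmbedding))]
    have image (a : Fin m) : ρ.viaFintypeEmbedding e.toEmbedding (e a) = e (ρ a) :=
      ρ.viaFintypeEmbedding_apply_image e.toEmbedding a
    simp [image]
  have average (π : Equiv.Perm (Fin n)) :
      ∑ ρ : Equiv.Perm (Fin m), Φ (fun a b => π (e (ρ a)) < π (e (ρ b)))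
        = ∑ τ : Equiv.Perm (Fin m), Φ (fun a b => τ a < τ b) := by
    set f : Fin m → Fin n := fun a => π (e a) with hf
    have hinj : Function.Injective f := π.injective.comp e.injective
    have hmono : StrictMono (f ∘ Tuple.sort f) :=
      (Tuple.monotone_sort f).strictMono_of_injective (hinj.comp (Tuple.sort f).injective)
    have hlt (a b : Fin m) : f a < f b ↔ (Tuple.sort f)⁻¹ a < (Tuple.sort f)⁻¹ b := by
      rw [← hmono.lt_iff_lt]
      simp
    refine Eq.trans ?_ (Equiv.sum_comp (Equiv.mulLeft (Tuple.sort f)⁻¹) _)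
    refine sum_congr rfl fun ρ _ => congrArg Φ ?_
    funext a b
    exact propext (hlt (ρ a) (ρ b))
  calc (m.factorial : ℚ) * ∑ π : Equiv.Perm (Fin n), Φ (fun a b => π (e a) < π (e b))
      = ∑ _ρ : Equiv.Perm (Fin m),
          ∑ π : Equiv.Perm (Fin n), Φ (fun a b => π (e a) < π (e b)) := by
        simp [Fintype.card_perm]
    _ = ∑ ρ : Equiv.Perm (Fin m),
          ∑ π : Equiv.Perm (Fin n), Φ (fun a b => π (e (ρ a)) < π (e (ρ b))) :=
        sum_congr rfl fun ρ _ => shift ρ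
    _ = _ := by
        rw [sum_comm, sum_congr rfl fun π _ => average π]
        simp [Fintype.card_perm]

open Finset in
open scoped Classical in
/-- The mean of a statistic counting the maps `h : ι → Fin n` which satisfy a condition on the
relative orders of `h` and of `π ∘ h` is a combination of the binomials `n.choose m` with
`m ≤ Fintype.card ι`, whose coefficients do not depend on `n`. -/
theorem exists_sum_perm_card_eq_sum_choose {ι : Type*} [Fintype ι]
    (Q : (ι → ι → Prop) → (ι → ι → Prop) → Prop) :
    ∃ K : ℕ → ℚ, ∀ n : ℕ,
      ∑ π : Equiv.Perm (Fin n), (#{h : ι → Fin n |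
          Q (fun a b => h a < h b) (fun a b => π (h a) < π (h b))} : ℚ)
        = n.factorial * ∑ m ∈ range (Fintype.card ι + 1), n.choose m * K m := by
  let Φ (m : ℕ) (r : Fin m → Fin m → Prop) : ℚ :=
    #{h : ι → Fin m | Function.Surjective h ∧ Q (fun a b => h a < h b) (fun a b => r (h a) (h b))}
  let K (m : ℕ) : ℚ := (∑ τ : Equiv.Perm (Fin m), Φ m (fun a b => τ a < τ b)) / m.factorial
  have K_zero {m : ℕ} (hm : Fintype.card ι < m) : K m = 0 := by
    have hns (h : ι → Fin m) : ¬ Function.Surjective h := fun hs => by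
      simpa using (Fintype.card_le_of_surjective h hs).trans_lt hm
    simp [K, Φ, hns]
  have fiber {n : ℕ} (π : Equiv.Perm (Fin n)) (U : Finset (Fin n)) :
      (#{h : ι → Fin n | Q (fun a b => h a < h b) (fun a b => π (h a) < π (h b)) ∧
          univ.image h = U} : ℚ)
        = Φ #U (fun a b => π (U.orderEmbOfFin rfl a) < π (U.orderEmbOfFin rfl b)) := by
    set e := U.orderEmbOfFin rfl with he
    have hrange (x : Fin n) : x ∈ U ↔ ∃ y, e y = x := by
      rw [← Finset.mem_coe, ← U.range_orderEmbOfFin rfl, Set.mem_range]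
    refine congrArg Nat.cast (Eq.symm ?_)
    refine card_bij (fun h _ a => e (h a)) ?_ ?_ ?_
    · intro h hh
      simp only [mem_filter, mem_univ, true_and] at hh ⊢
      refine ⟨by simpa using hh.2, ?_⟩
      ext x
      rw [hrange]
      simp only [mem_image, mem_univ, true_and]
      constructor
      · rintro ⟨a, rfl⟩
        exact ⟨_, rfl⟩
      · rintro ⟨y, rfl⟩
        obtain ⟨a, rfl⟩ := hh.1 y
        exact ⟨a, rfl⟩
    · intro h _ h' _ heq
      funext a
      exact e.injective (congrFun heq a)
    · intro g hg
      simp only [mem_filter, mem_univ, true_and] at hg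
      obtain ⟨hQ, hU⟩ := hg
      have hex (a : ι) : ∃ y, e y = g a := by
        rw [← hrange, ← hU]
        exact mem_image_of_mem g (mem_univ a)
      choose h hh using hex
      obtain rfl : (fun a => e (h a)) = g := funext hh
      refine ⟨h, ?_, rfl⟩
      simp only [mem_filter, mem_univ, true_and]
      refine ⟨fun y => ?_, by simpa using hQ⟩
      have hy : e y ∈ univ.image fun a => e (h a) := by
        rw [hU, hrange]
        exact ⟨y, rfl⟩
      obtain ⟨a, -, ha⟩ := mem_image.mp hy
      exact ⟨a, e.injective ha⟩
  refine ⟨K, fun n => ?_⟩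
  have hK (U : Finset (Fin n)) :
      ∑ π : Equiv.Perm (Fin n),
          Φ #U (fun a b => π (U.orderEmbOfFin rfl a) < π (U.orderEmbOfFin rfl b))
        = n.factorial * K #U := by
    have h := factorial_mul_sum_perm_comp_orderEmbedding (U.orderEmbOfFin rfl) (Φ #U)
    have hpos : ((#U).factorial : ℚ) ≠ 0 := by positivity
    simp only [K]
    field_simp
    linarith
  calc _ = ∑ π : Equiv.Perm (Fin n), ∑ U : Finset (Fin n),
          Φ #U (fun a b => π (U.orderEmbOfFin rfl a) < π (U.orderEmbOfFin rfl b)) := by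
        refine sum_congr rfl fun π _ => ?_
        rw [card_eq_sum_card_fiberwise (f := fun h => univ.image h) (t := univ)
          (fun _ _ => mem_coe.mpr (mem_univ _)), Nat.cast_sum]
        refine sum_congr rfl fun U _ => ?_
        rw [← fiber, filter_filter]
    _ = n.factorial * ∑ U : Finset (Fin n), K #U := by
        rw [sum_comm, sum_congr rfl fun U _ => hK U, mul_sum]
    _ = n.factorial * ∑ m ∈ range (n + 1), n.choose m * K m := by
        rw [← powerset_univ, sum_powerset_apply_card]
        simp
    _ = _ := by
        congr 1
        rw [sum_subset (range_mono (Nat.le_add_right (n + 1) (Fintype.card ι))),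
          sum_subset (range_mono (show Fintype.card ι + 1 ≤ n + 1 + Fintype.card ι by lia))]
        · intro m _ hm
          rw [K_zero (by simpa using hm), mul_zero]
        · intro m _ hm
          rw [Nat.choose_eq_zero_of_lt (by simpa using hm), Nat.cast_zero, zero_mul]

open Finset in
theorem exists_sum_occ_eq_sum_choose {k : ℕ} (σ : Equiv.Perm (Fin k)) :
    ∃ K : ℕ → ℚ, ∀ n : ℕ, ∑ π : Equiv.Perm (Fin n), (occ σ π : ℚ)
      = n.factorial * ∑ m ∈ range (k + 1), n.choose m * K m := by
  classical
  obtain ⟨K, hK⟩ := exists_sum_perm_card_eq_sum_choose (ι := Fin k)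
    fun r s => (∀ a b, a < b → r a b) ∧ ∀ a b, s a b ↔ σ a < σ b
  refine ⟨K, fun n => ?_⟩
  rw [Fintype.card_fin] at hK
  rw [← hK n]
  refine sum_congr rfl fun π _ => ?_
  unfold occ
  congr!

open Finset in
theorem exists_sum_occ_sq_eq_sum_choose {k : ℕ} (σ : Equiv.Perm (Fin k)) :
    ∃ K : ℕ → ℚ, ∀ n : ℕ, ∑ π : Equiv.Perm (Fin n), (occ σ π : ℚ) ^ 2
      = n.factorial * ∑ m ∈ range (k + k + 1), n.choose m * K m := by
  classical
  obtain ⟨K, hK⟩ := exists_sum_perm_card_eq_sum_choose (ι := Fin k ⊕ Fin k)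
    fun r s =>
      ((∀ a b, a < b → r (.inl a) (.inl b)) ∧ ∀ a b, s (.inl a) (.inl b) ↔ σ a < σ b) ∧
      ((∀ a b, a < b → r (.inr a) (.inr b)) ∧ ∀ a b, s (.inr a) (.inr b) ↔ σ a < σ b)
  refine ⟨K, fun n => ?_⟩
  rw [Fintype.card_sum, Fintype.card_fin] at hK
  rw [← hK n]
  refine sum_congr rfl fun π _ => ?_
  unfold occ
  rw [sq, ← Nat.cast_mul, ← card_product]
  refine congrArg Nat.cast (card_equiv (Equiv.sumArrowEquivProdArrow _ _ _).symm ?_)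
  rintro ⟨f, g⟩
  simp

open Finset in
/-- A form of `occ p123` which the kernel evaluates efficiently. -/
theorem occ_p123_eq_sum {n : ℕ} (π : Equiv.Perm (Fin n)) :
    occ p123 π = ∑ c : Fin n, ∑ b : Fin n,
      if b < c ∧ π b < π c then #{a : Fin n | a < b ∧ π a < π b} else 0 := by
  have key : occ p123 π = #{p : Fin n × Fin n × Fin n |
      (p.2.1 < p.1 ∧ π p.2.1 < π p.1) ∧ (p.2.2 < p.2.1 ∧ π p.2.2 < π p.2.1)} := by
    refine card_bij (fun f _ => (f 2, f 1, f 0)) ?_ ?_ ?_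
    · intro f hf
      simp only [mem_filter, mem_univ, true_and] at hf ⊢
      exact ⟨⟨hf.1 1 2 (by decide), (hf.2 1 2).2 (by decide)⟩,
        hf.1 0 1 (by decide), (hf.2 0 1).2 (by decide)⟩
    · intro f _ g _ h
      simp only [Prod.mk.injEq] at h
      funext i
      fin_cases i
      exacts [h.2.2, h.2.1, h.1]
    · rintro ⟨c, b, a⟩ h
      simp only [mem_filter, mem_univ, true_and] at h
      obtain ⟨⟨hbc, hbc'⟩, hab, hab'⟩ := h
      refine ⟨![a, b, c], ?_, rfl⟩
      have hmono : StrictMono ![a, b, c] := by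
        rw [Fin.strictMono_iff_lt_succ]
        intro i
        fin_cases i
        exacts [hab, hbc]
      have hmono' : StrictMono fun i => π (![a, b, c] i) := by
        rw [Fin.strictMono_iff_lt_succ]
        intro i
        fin_cases i
        exacts [hab', hbc']
      simp only [mem_filter, mem_univ, true_and]
      exact ⟨fun i j hij => hmono hij, fun i j => hmono'.lt_iff_lt⟩
  rw [key, card_filter, Fintype.sum_prod_type]
  refine sum_congr rfl fun c _ => ?_
  rw [Fintype.sum_prod_type]
  refine sum_congr rfl fun b _ => ?_
  split_ifs with h
  · simp only [h, true_and, and_self]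
    rw [card_filter]
  · simp [h]

theorem sum_occ_p123_sq_of_le_six (n : ℕ) (hn : n ≤ 6) :
    ∑ π : Equiv.Perm (Fin n), occ p123 π ^ 2 = ![0, 0, 0, 1, 34, 776, 15436] (Fin.ofNat 7 n) := by
  simp only [occ_p123_eq_sum]
  interval_cases n <;> decide +kernel

theorem sum_occ_p123_of_le_three (n : ℕ) (hn : n ≤ 3) :
    ∑ π : Equiv.Perm (Fin n), occ p123 π = ![0, 0, 0, 1] (Fin.ofNat 4 n) := by
  simp only [occ_p123_eq_sum]
  interval_cases n <;> decide +kernel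

/-- The mean of the number of occurrences of 123. -/
theorem sum_occ_p123 (n : ℕ) :
    ∑ π : Equiv.Perm (Fin n), (occ p123 π : ℚ) = n.factorial * ((n.choose 3 : ℚ) / 6) := by
  obtain ⟨K, hK⟩ := exists_sum_occ_eq_sum_choose p123
  have value (m : ℕ) (hm : m ≤ 3) := (hK m).symm.trans
    (by rw [← Nat.cast_sum, sum_occ_p123_of_le_three m hm])
  have h0 := value 0 (by lia)
  have h1 := value 1 (by lia)
  have h2 := value 2 (by lia)
  have h3 := value 3 (by lia)
  simp [Finset.sum_range_succ, Nat.choose, Nat.factorial, Fin.ofNat] at h0 h1 h2 h3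
  have k1 : K 1 = 0 := by linarith
  have k2 : K 2 = 0 := by linarith
  have k3 : K 3 = 1 / 6 := by linarith
  rw [hK n]
  simp only [Finset.sum_range_succ, Finset.sum_range_zero, h0, k1, k2, k3]
  ring

theorem sum_occ_p123_sq (n : ℕ) :
    ∑ π : Equiv.Perm (Fin n), (occ p123 π : ℚ) ^ 2
      = n.factorial * ((n.choose 3 : ℚ) / 6 + n.choose 4 * (3 / 4)
          + n.choose 5 * (21 / 20) + n.choose 6 * (5 / 9)) := by
  obtain ⟨K, hK⟩ := exists_sum_occ_sq_eq_sum_choose p123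
  have value (m : ℕ) (hm : m ≤ 6) := (hK m).symm.trans
    (by simp_rw [← Nat.cast_pow]; rw [← Nat.cast_sum, sum_occ_p123_sq_of_le_six m hm])
  have h0 := value 0 (by lia)
  have h1 := value 1 (by lia)
  have h2 := value 2 (by lia)
  have h3 := value 3 (by lia)
  have h4 := value 4 (by lia)
  have h5 := value 5 (by lia)
  have h6 := value 6 (by lia)
  simp [Finset.sum_range_succ, Nat.choose, Nat.factorial, Fin.ofNat] at h0 h1 h2 h3 h4 h5 h6
  have k1 : K 1 = 0 := by linarith
  have k2 : K 2 = 0 := by linarith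
  have k3 : K 3 = 1 / 6 := by linarith
  have k4 : K 4 = 3 / 4 := by linarith
  have k5 : K 5 = 21 / 20 := by linarith
  have k6 : K 6 = 5 / 9 := by linarith
  rw [hK n]
  simp only [Finset.sum_range_succ, Finset.sum_range_zero, h0, k1, k2, k3, k4, k5, k6]
  ring

theorem stmt1 (n : ℕ) (hn : 1 ≤ n) :
    (1 / (n.factorial : ℚ)) * ∑ π : Equiv.Perm (Fin n),
        ((occ p123 π : ℚ) - (n.choose 3 : ℚ) / 6) ^ 2
      = (n : ℚ) * ((n : ℚ) - 1) * ((n : ℚ) - 2)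
        * (39 * (n : ℚ) ^ 2 + 102 * (n : ℚ) - 157) / 21600 := by
  have hfact : (n.factorial : ℚ) ≠ 0 := by positivity
  have hmean := sum_occ_p123 n
  have hsq := sum_occ_p123_sq n
  have hcard : ∑ _π : Equiv.Perm (Fin n), ((n.choose 3 : ℚ) / 6) ^ 2
      = n.factorial * ((n.choose 3 : ℚ) / 6) ^ 2 := by
    simp [Fintype.card_perm]
  have expand : ∑ π : Equiv.Perm (Fin n), ((occ p123 π : ℚ) - (n.choose 3 : ℚ) / 6) ^ 2
      = n.factorial * ((n.choose 3 : ℚ) / 6 + n.choose 4 * (3 / 4)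
          + n.choose 5 * (21 / 20) + n.choose 6 * (5 / 9) - ((n.choose 3 : ℚ) / 6) ^ 2) := by
    simp only [sub_sq, Finset.sum_add_distrib, Finset.sum_sub_distrib, ← Finset.sum_mul,
      ← Finset.mul_sum]
    rw [hcard, hsq, hmean]
    ring
  rw [expand, ← mul_assoc, one_div, inv_mul_cancel₀ hfact, one_mul]
  simp only [Nat.cast_choose_eq_descPochhammer_div, descPochhammer_succ_eval,
    descPochhammer_zero, Polynomial.eval_one, Nat.factorial]
  push_cast
  ring
end

section
/- For every n ≥ 1, the third central moment of the number of occurrences of the pattern 123 in a uniformly random permutation of S_n satisfies (1/n!)·∑_{π ∈ S_n} (N_{123}(π) − binom(n,3)/6)³ = n(n−1)(n−2)(1437n⁴ + 5592n³ − 11277n² − 33990n + 34082)/6350400. -/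
/-- Shift of values making room for a new value `p`. -/
def shiftFrom (p v : ℕ) : ℕ := if v < p then v else v + 1

lemma shiftFrom_lt_iff (p v w : ℕ) : shiftFrom p v < shiftFrom p w ↔ v < w := by
  unfold shiftFrom; split_ifs <;> omega

lemma lt_shiftFrom_iff (p v : ℕ) : p < shiftFrom p v ↔ p ≤ v := by
  unfold shiftFrom; split_ifs <;> omega

/-- The number of later entries of the word `w` exceeding the entry at `i`. -/
def ascents {n : ℕ} (w : Fin n → ℕ) (i : Fin n) : ℕ :=
  ∑ k, if i < k ∧ w i < w k then 1 else 0

/-- The number of occurrences of `123` in the word `w`. -/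
def triples {n : ℕ} (w : Fin n → ℕ) : ℕ :=
  ∑ i, ∑ j, if i < j ∧ w i < w j then ascents w j else 0

/-- The entries of `w` paired with their ascent numbers, and the number of `123`s. -/
def wordState {n : ℕ} (w : Fin n → ℕ) : List (ℕ × ℕ) × ℕ :=
  (List.ofFn fun i => (w i, ascents w i), triples w)

/-- The effect on `wordState` of inserting `p` as a new first entry. -/
def insertFront (s : List (ℕ × ℕ) × ℕ) (p : ℕ) : List (ℕ × ℕ) × ℕ :=
  ((p, (s.1.map fun x => if p ≤ x.1 then 1 else 0).sum) ::
      s.1.map fun x => (shiftFrom p x.1, x.2),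
    (s.1.map fun x => if p ≤ x.1 then x.2 else 0).sum + s.2)

lemma wordState_cons {n : ℕ} (w : Fin n → ℕ) (p : ℕ) :
    wordState (Fin.cons p (fun i => shiftFrom p (w i)) : Fin (n + 1) → ℕ) =
      insertFront (wordState w) p := by
  have hasc : ∀ i : Fin n,
      ascents (Fin.cons p (fun i => shiftFrom p (w i)) : Fin (n + 1) → ℕ) i.succ
        = ascents w i := by
    intro i
    simp [ascents, Fin.sum_univ_succ, shiftFrom_lt_iff, -Finset.sum_boole]
  refine Prod.ext ?_ ?_
  · simp only [wordState, insertFront, List.ofFn_succ, Fin.cons_zero, Fin.cons_succ, hasc,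
      List.map_ofFn, List.sum_ofFn, Function.comp_def]
    simp [ascents, Fin.sum_univ_succ, lt_shiftFrom_iff, -Finset.sum_boole]
  · simp only [wordState, insertFront, List.map_ofFn, List.sum_ofFn, Function.comp_def, triples]
    simp [Fin.sum_univ_succ, lt_shiftFrom_iff, shiftFrom_lt_iff, hasc]

/-- The sum of `G` over the states of all permutations of `Fin n`, as an iterated sum. -/
def stateSum {M : Type*} [AddCommMonoid M] : ℕ → (List (ℕ × ℕ) × ℕ → M) → M
  | 0, G => G ([], 0)
  | n + 1, G => stateSum n fun s => ((List.range (n + 1)).map fun p => G (insertFront s p)).sum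

/-- The permutation obtained by putting `p` in front of `e`. -/
noncomputable def consPerm {n : ℕ} (p : Fin (n + 1)) (e : Equiv.Perm (Fin n)) : Equiv.Perm (Fin (n + 1)) :=
  Equiv.ofBijective (Fin.cons p fun i => p.succAbove (e i)) <|
    Finite.injective_iff_bijective.mp <| Fin.cons_injective_iff.mpr
      ⟨by simp [Fin.succAbove_ne], p.succAbove_right_injective.comp e.injective⟩

lemma coe_consPerm {n : ℕ} (p : Fin (n + 1)) (e : Equiv.Perm (Fin n)) :
    ⇑(consPerm p e) = Fin.cons p fun i => p.succAbove (e i) := rfl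

lemma sum_perm_succ {n : ℕ} {M : Type*} [AddCommMonoid M] (G : Equiv.Perm (Fin (n + 1)) → M) :
    ∑ π, G π = ∑ e : Equiv.Perm (Fin n), ∑ p, G (consPerm p e) := by
  have hinj : Function.Injective
      fun x : Equiv.Perm (Fin n) × Fin (n + 1) => consPerm x.2 x.1 := by
    rintro ⟨e, p⟩ ⟨e', p'⟩ h
    have h := congrArg (fun π : Equiv.Perm (Fin (n + 1)) => (π : Fin (n + 1) → _)) h
    simp only [coe_consPerm] at h
    obtain ⟨rfl, h⟩ := Fin.cons_injective2 h
    have : e = e' := Equiv.ext fun i => p.succAbove_right_injective (congrFun h i)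
    rw [this]
  have hbij := (Fintype.bijective_iff_injective_and_card _).mpr ⟨hinj, by
    simp [Fintype.card_perm, Nat.factorial_succ, mul_comm]⟩
  rw [← Fintype.sum_prod_type']
  exact (Fintype.sum_bijective _ hbij _ _ fun _ => rfl).symm

lemma wordState_consPerm {n : ℕ} (p : Fin (n + 1)) (e : Equiv.Perm (Fin n)) :
    wordState (fun i => (consPerm p e i : ℕ)) = insertFront (wordState fun i => (e i : ℕ)) p := by
  rw [← wordState_cons]
  congr 1
  funext i
  refine Fin.cases ?_ (fun i => ?_) i
  · simp [coe_consPerm]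
  · simp only [coe_consPerm, Fin.cons_succ, shiftFrom, Fin.succAbove, Fin.lt_def]
    split_ifs <;> simp_all

lemma sum_wordState {M : Type*} [AddCommMonoid M] (n : ℕ) (G : List (ℕ × ℕ) × ℕ → M) :
    ∑ π : Equiv.Perm (Fin n), G (wordState fun i => (π i : ℕ)) = stateSum n G := by
  induction n generalizing G with
  | zero => simp [stateSum, wordState, triples]
  | succ n ih =>
    simp only [sum_perm_succ, wordState_consPerm]
    rw [ih fun s => ∑ p : Fin (n + 1), G (insertFront s p), stateSum]
    congr 1
    funext s
    rw [← Fin.sum_ofFn, List.ofFn_eq_map, ← List.map_coe_finRange_eq_range, List.map_map]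
    rfl

lemma occ_p123_eq_triples {n : ℕ} (π : Equiv.Perm (Fin n)) :
    occ p123 π = triples fun i => (π i : ℕ) := by
  let φ : (Fin 3 → Fin n) ≃ Fin n × Fin n × Fin n :=
    { toFun f := (f 0, f 1, f 2)
      invFun x := ![x.1, x.2.1, x.2.2]
      left_inv f := by funext i; fin_cases i <;> rfl
      right_inv x := rfl }
  have h : ∀ f : Fin 3 → Fin n, ((∀ a b : Fin 3, a < b → f a < f b) ∧
      ∀ a b : Fin 3, π (f a) < π (f b) ↔ p123 a < p123 b) ↔
      (f 0 < f 1 ∧ π (f 0) < π (f 1)) ∧ (f 1 < f 2 ∧ π (f 1) < π (f 2)) := by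
    intro f
    simp only [p123, Equiv.Perm.one_apply, Fin.forall_fin_succ]
    simp
    grind
  rw [occ, Finset.card_filter, triples]
  simp only [h, ascents, Fin.val_fin_lt]
  refine (Fintype.sum_equiv φ _ (fun x : Fin n × Fin n × Fin n =>
    if (x.1 < x.2.1 ∧ π x.1 < π x.2.1) ∧ (x.2.1 < x.2.2 ∧ π x.2.1 < π x.2.2) then 1 else 0)
    (fun f => rfl)).trans ?_
  simp only [Fintype.sum_prod_type, ite_and, Finset.sum_ite_irrel, Finset.sum_const_zero]

open Finset

section OrderType

variable {m n : ℕ}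

lemma exists_perm_same_order (u : Fin m → Fin n) (hu : Function.Injective u) :
    ∃ s : Equiv.Perm (Fin m), ∀ a b, u a < u b ↔ s a < s b := by
  have hs : StrictMono (u ∘ Tuple.sort u) :=
    (Tuple.monotone_sort u).strictMono_of_injective (hu.comp (Tuple.sort u).injective)
  refine ⟨(Tuple.sort u)⁻¹, fun a b => ?_⟩
  rw [← hs.lt_iff_lt]
  simp

/-- A statistic on words that only depends on the relative order of the letters. -/
def OrderInvariant (D : ∀ {n : ℕ}, (Fin m → Fin n) → ℚ) : Prop :=
  ∀ {n n' : ℕ} (u : Fin m → Fin n) (v : Fin m → Fin n'),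
    (∀ a b, u a < u b ↔ v a < v b) → D u = D v

lemma sum_comp_perm {D : ∀ {n : ℕ}, (Fin m → Fin n) → ℚ} (hD : OrderInvariant @D)
    (u : Fin m → Fin n) (hu : Function.Injective u) :
    ∑ τ : Equiv.Perm (Fin m), D (u ∘ τ) = ∑ τ : Equiv.Perm (Fin m), D τ := by
  obtain ⟨s, hs⟩ := exists_perm_same_order u hu
  rw [← Equiv.sum_comp (Equiv.mulLeft s) fun τ => D τ]
  exact sum_congr rfl fun τ _ => hD _ _ fun a b => hs _ _

lemma card_mul_sum_perm_comp (e : Fin m ↪ Fin n) {D : ∀ {n : ℕ}, (Fin m → Fin n) → ℚ}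
    (hD : OrderInvariant @D) (G : Equiv.Perm (Fin n) → ℚ)
    (hG : ∀ π (τ : Equiv.Perm (Fin m)), G (π * τ.viaFintypeEmbedding e) = G π) :
    (m.factorial : ℚ) * ∑ π, G π * D (π ∘ e) =
      (∑ π, G π) * ∑ τ : Equiv.Perm (Fin m), D τ := by
  have key : ∀ τ : Equiv.Perm (Fin m),
      ∑ π, G π * D (π ∘ e) = ∑ π : Equiv.Perm (Fin n), G π * D ((π ∘ e) ∘ τ) := by
    intro τ
    rw [← Equiv.sum_comp (Equiv.mulRight (τ.viaFintypeEmbedding e))]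
    refine sum_congr rfl fun π _ => ?_
    rw [Equiv.coe_mulRight, hG]
    congr 2
    funext a
    simp
  calc (m.factorial : ℚ) * ∑ π, G π * D (π ∘ e)
      = ∑ τ : Equiv.Perm (Fin m), ∑ π : Equiv.Perm (Fin n), G π * D ((π ∘ e) ∘ τ) := by
        rw [← sum_congr rfl fun τ _ => key τ]
        simp [Fintype.card_perm]
    _ = _ := by
        rw [sum_comm, sum_mul]
        refine sum_congr rfl fun π _ => ?_
        rw [← mul_sum, sum_comp_perm hD _ (π.injective.comp e.injective)]

end OrderType

/-- The centred indicator of a word of length three being increasing. -/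
def centredIncr {n : ℕ} (u : Fin 3 → Fin n) : ℚ := (if StrictMono u then 1 else 0) - 1 / 6

lemma orderInvariant_centredIncr : OrderInvariant @centredIncr := by
  intro n n' u v h
  simp only [centredIncr, StrictMono, h]

lemma sum_centredIncr : ∑ τ : Equiv.Perm (Fin 3), centredIncr τ = 0 := by
  have h : ∑ τ : Equiv.Perm (Fin 3), (if StrictMono τ then 1 else 0) = 1 := by decide
  have h' : ∑ τ : Equiv.Perm (Fin 3), (if StrictMono τ then (1 : ℚ) else 0) = 1 := by
    exact_mod_cast h
  simp only [centredIncr, sum_sub_distrib, h']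
  simp [Fintype.card_perm, Nat.factorial]

/-- The positions used by an increasing triple of indices. -/
def support {n : ℕ} (f : Fin 3 ↪o Fin n) : Finset (Fin n) := univ.map f.toEmbedding

lemma card_support {n : ℕ} (f : Fin 3 ↪o Fin n) : (support f).card = 3 := by
  simp [support]

/-- The sum over all permutations of the product of three centred indicators. -/
def mixedMoment {n : ℕ} (t : (Fin 3 ↪o Fin n) × (Fin 3 ↪o Fin n) × (Fin 3 ↪o Fin n)) : ℚ :=
  ∑ π : Equiv.Perm (Fin n), centredIncr (π ∘ t.1) * centredIncr (π ∘ t.2.1) *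
    centredIncr (π ∘ t.2.2)

lemma comp_viaFintypeEmbedding_of_disjoint {n : ℕ} {f h : Fin 3 ↪o Fin n}
    (hd : Disjoint (support f) (support h)) (π : Equiv.Perm (Fin n)) (τ : Equiv.Perm (Fin 3)) :
    ⇑(π * τ.viaFintypeEmbedding h.toEmbedding) ∘ f = π ∘ f := by
  funext a
  have : f a ∉ Set.range h.toEmbedding := by
    rintro ⟨b, hb⟩
    exact disjoint_left.mp hd (mem_map_of_mem _ (mem_univ a)) (by
      rw [RelEmbedding.coe_toEmbedding] at hb
      simp [support, ← hb])
  simp [Equiv.Perm.viaFintypeEmbedding_apply_notMem_range _ _ this]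

lemma mixedMoment_eq_zero_of_disjoint {n : ℕ} {f g h : Fin 3 ↪o Fin n}
    (hf : Disjoint (support f) (support h)) (hg : Disjoint (support g) (support h)) :
    mixedMoment (f, g, h) = 0 := by
  have := card_mul_sum_perm_comp h.toEmbedding orderInvariant_centredIncr
    (fun π => centredIncr (π ∘ f) * centredIncr (π ∘ g)) fun π τ => by
      simp only [comp_viaFintypeEmbedding_of_disjoint hf, comp_viaFintypeEmbedding_of_disjoint hg]
  rw [sum_centredIncr, mul_zero] at this
  exact (mul_eq_zero.mp this).resolve_left (by positivity)

/-- The union of the supports of three triples. -/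
def tripleSupport {n : ℕ} (t : (Fin 3 ↪o Fin n) × (Fin 3 ↪o Fin n) × (Fin 3 ↪o Fin n)) :
    Finset (Fin n) := support t.1 ∪ support t.2.1 ∪ support t.2.2

lemma card_union_le_seven {α : Type*} [DecidableEq α] {A B C : Finset α} (hA : A.card = 3)
    (hB : B.card = 3) (hC : C.card = 3) (h₁ : ¬ (Disjoint B A ∧ Disjoint C A))
    (h₂ : ¬ (Disjoint A B ∧ Disjoint C B)) (h₃ : ¬ (Disjoint A C ∧ Disjoint B C)) :
    (A ∪ B ∪ C).card ≤ 7 := by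
  have key : ∀ X Y : Finset α, ¬ Disjoint X Y → 1 ≤ (X ∩ Y).card := fun X Y h =>
    card_pos.mpr (not_disjoint_iff_nonempty_inter.mp h)
  have hAB := card_union_add_card_inter A B
  have hABC := card_union_add_card_inter (A ∪ B) C
  have hmono₁ : (A ∩ C).card ≤ ((A ∪ B) ∩ C).card := card_le_card (by grind)
  have hmono₂ : (B ∩ C).card ≤ ((A ∪ B) ∩ C).card := card_le_card (by grind)
  by_cases h : Disjoint A B
  · have hAC := key A C fun hd => h₁ ⟨h.symm, hd.symm⟩
    have hBC := key B C fun hd => h₂ ⟨h, hd.symm⟩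
    have : (A ∩ C).card + (B ∩ C).card = ((A ∪ B) ∩ C).card := by
      rw [union_inter_distrib_right, card_union_of_disjoint]
      exact h.mono inter_subset_left inter_subset_left
    omega
  · have := key A B h
    have : 1 ≤ ((A ∪ B) ∩ C).card := by
      by_cases hAC : Disjoint A C
      · have := key B C fun hd => h₃ ⟨hAC, hd⟩
        omega
      · have := key A C hAC
        omega
    omega

lemma mixedMoment_eq_zero {n : ℕ} (t : (Fin 3 ↪o Fin n) × (Fin 3 ↪o Fin n) × (Fin 3 ↪o Fin n))
    (ht : 8 ≤ (tripleSupport t).card) : mixedMoment t = 0 := by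
  obtain ⟨f, g, h⟩ := t
  have hfgh : mixedMoment (f, g, h) = mixedMoment (g, h, f) := by
    simp only [mixedMoment]; exact sum_congr rfl fun _ _ => by ring
  have hfhg : mixedMoment (f, g, h) = mixedMoment (f, h, g) := by
    simp only [mixedMoment]; exact sum_congr rfl fun _ _ => by ring
  by_contra hne
  have := card_union_le_seven (card_support f) (card_support g) (card_support h)
    (fun hd => hne (hfgh.trans (mixedMoment_eq_zero_of_disjoint hd.1 hd.2)))
    (fun hd => hne (hfhg.trans (mixedMoment_eq_zero_of_disjoint hd.1 hd.2)))
    (fun hd => hne (mixedMoment_eq_zero_of_disjoint hd.1 hd.2))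
  simp only [tripleSupport] at ht
  omega

/-- The cube of the centred number of increasing triples in a word. -/
noncomputable def centredCube {m n : ℕ} (u : Fin m → Fin n) : ℚ :=
  (∑ f : Fin 3 ↪o Fin m, centredIncr (u ∘ f)) ^ 3

lemma orderInvariant_centredCube (m : ℕ) : OrderInvariant (@centredCube m) := by
  intro n n' u v h
  simp only [centredCube]
  congr 1
  exact sum_congr rfl fun f _ => orderInvariant_centredIncr _ _ fun a b => h _ _

/-- The third central moment of the number of increasing triples in a random permutation. -/
noncomputable def thirdMoment (n : ℕ) : ℚ := (∑ π : Equiv.Perm (Fin n), centredCube π) / n.factorial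

lemma sum_support_subset {n : ℕ} (U : Finset (Fin n)) (F : (Fin 3 ↪o Fin n) → ℚ) :
    ∑ f with support f ⊆ U, F f =
      ∑ f : Fin 3 ↪o Fin U.card, F (f.trans (U.orderEmbOfFin rfl)) := by
  symm
  refine sum_bij (fun f _ => f.trans (U.orderEmbOfFin rfl)) ?_ ?_ ?_ fun _ _ => rfl
  · intro f _
    refine mem_filter.mpr ⟨mem_univ _, fun x hx => ?_⟩
    obtain ⟨a, -, rfl⟩ := mem_map.mp hx
    exact orderEmbOfFin_mem U rfl _
  · intro f _ g _ h
    refine DFunLike.ext _ _ fun a => ?_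
    simpa using DFunLike.congr_fun h a
  · intro f hf
    have hf : ∀ a, f a ∈ U := fun a =>
      (mem_filter_univ f).mp hf (mem_map_of_mem _ (mem_univ a))
    let g : Fin 3 → Fin U.card := fun a => (U.orderIsoOfFin rfl).symm ⟨f a, hf a⟩
    have hg : StrictMono g := fun a b hab => by simpa [g] using hab
    refine ⟨OrderEmbedding.ofStrictMono g hg, mem_univ _, ?_⟩
    ext a
    simp [g, orderEmbOfFin]

lemma sum_mixedMoment_subset {n : ℕ} (U : Finset (Fin n)) :
    ∑ t with tripleSupport t ⊆ U, mixedMoment t = n.factorial * thirdMoment U.card := by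
  have h := card_mul_sum_perm_comp (U.orderEmbOfFin rfl).toEmbedding
    (orderInvariant_centredCube U.card) (fun _ : Equiv.Perm (Fin n) => 1) fun _ _ => rfl
  have hfilter : (univ.filter fun t : (Fin 3 ↪o Fin n) × (Fin 3 ↪o Fin n) × (Fin 3 ↪o Fin n) =>
      tripleSupport t ⊆ U) = (univ.filter fun f => support f ⊆ U) ×ˢ
        (univ.filter fun f => support f ⊆ U) ×ˢ (univ.filter fun f => support f ⊆ U) := by
    ext t
    simp only [mem_filter_univ, mem_product, tripleSupport, union_subset_iff, and_assoc]
  simp only [one_mul, sum_const, card_univ, Fintype.card_perm, Fintype.card_fin, nsmul_eq_mul,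
    mul_one] at h
  rw [thirdMoment, mul_div_assoc', ← h, mul_div_cancel_left₀ _ (by positivity)]
  simp only [mixedMoment]
  rw [sum_comm]
  refine sum_congr rfl fun π _ => ?_
  rw [hfilter, sum_product]
  simp only [sum_product, mul_assoc, ← mul_sum, ← sum_mul]
  rw [sum_support_subset U fun f => centredIncr (π ∘ f), centredCube, pow_three]
  rfl

lemma exists_binomial_coeffs {R : Type*} [AddCommGroup R] (M : ℕ → R) :
    ∃ c : ℕ → R, ∀ n, M n = ∑ k ∈ range (n + 1), n.choose k • c k :=
  ⟨fun k => (fwdDiff 1)^[k] M 0, fun n => by simpa using shift_eq_sum_fwdDiff_iter 1 M n 0⟩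

lemma thirdMoment_binomial :
    ∃ c : ℕ → ℚ, (∀ n, thirdMoment n = ∑ k ∈ range (n + 1), n.choose k • c k) ∧
      ∀ k, 8 ≤ k → c k = 0 := by
  obtain ⟨c, hc⟩ := exists_binomial_coeffs thirdMoment
  refine ⟨c, hc, fun n hn => ?_⟩
  have hφ : ∀ U : Finset (Fin n),
      ∑ t with tripleSupport t = U, mixedMoment t = n.factorial * c U.card := by
    intro U
    induction U using Finset.strongInduction with
    | H U ih =>
      have h₁ : ∑ V ∈ U.powerset, ∑ t with tripleSupport t = V, mixedMoment t =
          n.factorial * thirdMoment U.card := by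
        rw [← sum_mixedMoment_subset, ← sum_fiberwise_of_maps_to
          (t := U.powerset) (g := tripleSupport) (by simp)]
        refine sum_congr rfl fun V hV => ?_
        rw [filter_filter]
        refine sum_congr (filter_congr fun t _ => ?_) fun _ _ => rfl
        have := mem_powerset.mp hV
        grind
      have h₂ : ∑ V ∈ U.powerset, (n.factorial : ℚ) * c V.card =
          n.factorial * thirdMoment U.card := by
        rw [← mul_sum, sum_powerset_apply_card, hc]
      rw [← h₂, ← insert_erase (mem_powerset_self U), sum_insert (by simp),
        sum_insert (by simp)] at h₁
      have h₃ : ∑ V ∈ U.powerset.erase U, ∑ t with tripleSupport t = V, mixedMoment t =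
          ∑ V ∈ U.powerset.erase U, (n.factorial : ℚ) * c V.card :=
        sum_congr rfl fun V hV => ih V (by grind)
      rwa [h₃, add_left_inj] at h₁
  have h := hφ univ
  rw [sum_eq_zero fun t ht => mixedMoment_eq_zero t (by
    rw [(mem_filter_univ t).mp ht]; simpa using hn), card_univ, Fintype.card_fin] at h
  exact (mul_eq_zero.mp h.symm).resolve_left (by positivity)

lemma thirdMoment_eq_sum_range_eight :
    ∃ c : ℕ → ℚ, ∀ n, thirdMoment n = ∑ k ∈ range 8, n.choose k * c k := by
  obtain ⟨c, hc, hc'⟩ := thirdMoment_binomial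
  refine ⟨c, fun n => ?_⟩
  rw [hc]
  simp only [nsmul_eq_mul]
  rcases le_total (n + 1) 8 with h | h
  · refine sum_subset (range_subset_range.mpr h) fun k _ hk => ?_
    rw [Nat.choose_eq_zero_of_lt (by simpa using hk)]
    simp
  · refine (sum_subset (range_subset_range.mpr h) fun k _ hk => ?_).symm
    rw [hc' k (by simpa using hk), mul_zero]

lemma card_orderEmb (k n : ℕ) : Fintype.card (Fin k ↪o Fin n) = n.choose k := by
  rw [← Nat.card_eq_fintype_card, Nat.card_congr Set.powersetCard.ofFinEmbEquiv]
  rw [Set.powersetCard.card, Nat.card_fin]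

lemma occ_p123_eq_card {n : ℕ} (π : Equiv.Perm (Fin n)) :
    occ p123 π = #{f : Fin 3 ↪o Fin n | StrictMono (π ∘ f)} := by
  symm
  refine card_bij (fun f _ => f) ?_ (fun f _ g _ h => DFunLike.coe_injective h) ?_
  · intro f hf
    exact mem_filter.mpr ⟨mem_univ _, fun a b => f.lt_iff_lt.mpr,
      fun a b => (mem_filter.mp hf).2.lt_iff_lt⟩
  · intro f hf
    obtain ⟨-, h₁, h₂⟩ := mem_filter.mp hf
    exact ⟨OrderEmbedding.ofStrictMono f h₁, mem_filter.mpr ⟨mem_univ _, fun a b => (h₂ a b).mpr⟩,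
      rfl⟩

lemma centredCube_perm {n : ℕ} (π : Equiv.Perm (Fin n)) :
    centredCube π = ((occ p123 π : ℚ) - (n.choose 3 : ℚ) / 6) ^ 3 := by
  simp only [centredCube, centredIncr, sum_sub_distrib, sum_boole, sum_const, card_univ,
    card_orderEmb, occ_p123_eq_card]
  simp [div_eq_mul_inv]

/-- The integer `(6 * N - C) ^ 3`; matching on `N` makes the kernel evaluate it only once. -/
def scaledCube (C : ℕ) : ℕ → ℤ
  | 0 => -(C * C * C)
  | N + 1 => (6 * (N + 1) - C) * (6 * (N + 1) - C) * (6 * (N + 1) - C)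

lemma scaledCube_eq (C N : ℕ) : scaledCube C N = (6 * N - C) ^ 3 := by
  cases N <;> simp only [scaledCube] <;> push_cast <;> ring

lemma thirdMoment_eq_stateSum (n : ℕ) :
    thirdMoment n = stateSum n (fun s => scaledCube (n.choose 3) s.2) / (216 * n.factorial) := by
  rw [← sum_wordState, thirdMoment, Int.cast_sum, ← div_div, sum_div _ _ (216 : ℚ)]
  congr 1
  refine sum_congr rfl fun π _ => ?_
  rw [centredCube_perm, occ_p123_eq_triples, scaledCube_eq, wordState]
  push_cast
  ring

lemma cast_choose_succ (n k : ℕ) :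
    (n.choose (k + 1) : ℚ) = n.choose k * (n - k) / (k + 1) := by
  rw [eq_div_iff (by positivity)]
  rcases le_total k n with h | h
  · have := Nat.choose_succ_right_eq n k
    rw [← Nat.cast_sub h]
    exact_mod_cast this
  · rcases h.eq_or_lt with rfl | h
    · simp
    · simp [Nat.choose_eq_zero_of_lt h, Nat.choose_eq_zero_of_lt (h.trans k.lt_succ_self)]

lemma stateSum_cube_sum :
    (List.range 8).map (fun n => stateSum n (fun s => scaledCube (n.choose 3) s.2)) =
      [0, 0, 0, 120, 8688, 288816, 7330464, 166027392] := by
  decide +kernel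

lemma thirdMoment_eq (n : ℕ) :
    thirdMoment n = (n : ℚ) * ((n : ℚ) - 1) * ((n : ℚ) - 2)
        * (1437 * (n : ℚ) ^ 4 + 5592 * (n : ℚ) ^ 3 - 11277 * (n : ℚ) ^ 2
            - 33990 * (n : ℚ) + 34082) / 6350400 := by
  obtain ⟨c, hc⟩ := thirdMoment_eq_sum_range_eight
  have h := stateSum_cube_sum
  simp only [List.range_succ, List.range_zero, List.nil_append, List.cons_append, List.map_cons,
    List.map_nil, List.cons.injEq] at h
  obtain ⟨h₀, h₁, h₂, h₃, h₄, h₅, h₆, h₇, -⟩ := h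
  have e₀ := hc 0
  have e₁ := hc 1
  have e₂ := hc 2
  have e₃ := hc 3
  have e₄ := hc 4
  have e₅ := hc 5
  have e₆ := hc 6
  have e₇ := hc 7
  rw [thirdMoment_eq_stateSum] at e₀ e₁ e₂ e₃ e₄ e₅ e₆ e₇
  rw [h₀] at e₀
  rw [h₁] at e₁
  rw [h₂] at e₂
  rw [h₃] at e₃
  rw [h₄] at e₄
  rw [h₅] at e₅
  rw [h₆] at e₆
  rw [h₇] at e₇
  rw [hc]
  simp only [sum_range_succ, sum_range_zero, cast_choose_succ, Nat.choose_zero_right,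
    Nat.factorial] at e₀ e₁ e₂ e₃ e₄ e₅ e₆ e₇ ⊢
  norm_num at e₀ e₁ e₂ e₃ e₄ e₅ e₆ e₇
  have k₁ : c 1 = 0 := by linarith
  have k₂ : c 2 = 0 := by linarith
  have k₃ : c 3 = 5 / 54 := by linarith
  have k₄ : c 4 = 47 / 36 := by linarith
  have k₅ : c 5 = 166 / 45 := by linarith
  have k₆ : c 6 = 107 / 30 := by linarith
  have k₇ : c 7 = 479 / 420 := by linarith
  rw [← e₀, k₁, k₂, k₃, k₄, k₅, k₆, k₇]
  push_cast
  ring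

theorem stmt2 (n : ℕ) (hn : 1 ≤ n) :
    (1 / (n.factorial : ℚ)) * ∑ π : Equiv.Perm (Fin n),
        ((occ p123 π : ℚ) - (n.choose 3 : ℚ) / 6) ^ 3
      = (n : ℚ) * ((n : ℚ) - 1) * ((n : ℚ) - 2)
        * (1437 * (n : ℚ) ^ 4 + 5592 * (n : ℚ) ^ 3 - 11277 * (n : ℚ) ^ 2
            - 33990 * (n : ℚ) + 34082) / 6350400 := by
  rw [← thirdMoment_eq, thirdMoment, one_div_mul_eq_div]
  simp only [centredCube_perm]
end

section
/- For every n ≥ 1, the second central moment of the number of occurrences of the pattern 132 in a uniformly random permutation of S_n satisfies (1/n!)·∑_{π ∈ S_n} (N_{132}(π) − binom(n,3)/6)² = n(n−1)(n−2)(21n² + 78n + 77)/21600. -/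
open Finset in
/-- Relative orders of the values on a set of `m` positions are equidistributed. -/
theorem sum_perm_comp_embedding {m n : ℕ} (e : Fin m ↪ Fin n)
    (F : (Fin m → Fin m → Prop) → ℚ) :
    (m.factorial : ℚ) * ∑ π : Equiv.Perm (Fin n), F (fun a b => π (e a) < π (e b))
      = n.factorial * ∑ ρ : Equiv.Perm (Fin m), F (fun a b => ρ a < ρ b) := by
  have relabel (τ : Equiv.Perm (Fin m)) :
      ∑ π : Equiv.Perm (Fin n), F (fun a b => π (e (τ a)) < π (e (τ b)))
        = ∑ π : Equiv.Perm (Fin n), F (fun a b => π (e a) < π (e b)) := by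
    refine Fintype.sum_equiv (Equiv.mulRight (τ.viaFintypeEmbedding e)) _ _ fun π => ?_
    simp [Equiv.Perm.viaFintypeEmbedding_apply_image]
  have standardize (π : Equiv.Perm (Fin n)) :
      ∑ τ : Equiv.Perm (Fin m), F (fun a b => π (e (τ a)) < π (e (τ b)))
        = ∑ ρ : Equiv.Perm (Fin m), F (fun a b => ρ a < ρ b) := by
    let f : Fin m → Fin n := fun a => π (e a)
    have hf : StrictMono (f ∘ Tuple.sort f) := (Tuple.monotone_sort f).strictMono_of_injective
      ((π.injective.comp e.injective).comp (Tuple.sort f).injective)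
    refine Fintype.sum_equiv (Equiv.mulLeft (Tuple.sort f)⁻¹) _ _ fun τ => ?_
    congr 1
    funext a b
    simpa [f] using hf.lt_iff_lt (a := (Tuple.sort f)⁻¹ (τ a)) (b := (Tuple.sort f)⁻¹ (τ b))
  calc _ = ∑ τ : Equiv.Perm (Fin m), ∑ π : Equiv.Perm (Fin n),
        F (fun a b => π (e (τ a)) < π (e (τ b))) := by
        simp [relabel, Fintype.card_perm]
    _ = _ := by
        rw [sum_comm]
        simp [standardize, Fintype.card_perm]

/-- All members of the family `h` of index tuples are occurrences of `σ` in a permutation whose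
values compare according to `r`. -/
def AllOcc {j k m : ℕ} (σ : Equiv.Perm (Fin k)) (h : Fin j → Fin k → Fin m)
    (r : Fin m → Fin m → Prop) : Prop :=
  ∀ i, (∀ a b : Fin k, a < b → h i a < h i b) ∧ ∀ a b : Fin k, r (h i a) (h i b) ↔ σ a < σ b

open Classical Finset in
theorem occ_pow {k n : ℕ} (σ : Equiv.Perm (Fin k)) (π : Equiv.Perm (Fin n)) (j : ℕ) :
    (occ σ π : ℚ) ^ j = ∑ h : Fin j → Fin k → Fin n,
      if AllOcc σ h (fun a b => π a < π b) then 1 else 0 := by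
  rw [occ, card_filter, Nat.cast_sum, Fintype.sum_pow]
  refine Fintype.sum_congr _ _ fun h => ?_
  push_cast
  rw [Finset.prod_boole]
  congr 1
  simp [AllOcc]

open Classical in
/-- The normalized number of families of `j` occurrences of `σ` in permutations of `S_m` which
together cover all `m` positions. -/
noncomputable def coverCoeff {k : ℕ} (σ : Equiv.Perm (Fin k)) (j m : ℕ) : ℚ :=
  (∑ h : Fin j → Fin k → Fin m with (∀ x, ∃ i a, h i a = x),
    ∑ ρ : Equiv.Perm (Fin m), if AllOcc σ h (fun a b => ρ a < ρ b) then 1 else 0) / m.factorial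

theorem coverCoeff_eq_zero {k : ℕ} (σ : Equiv.Perm (Fin k)) {j m : ℕ} (hm : j * k < m) :
    coverCoeff σ j m = 0 := by
  rw [coverCoeff, Finset.filter_false_of_mem, Finset.sum_empty, zero_div]
  intro h _ hs
  have hc := Fintype.card_le_of_surjective (fun p : Fin j × Fin k => h p.1 p.2) fun x => by
    obtain ⟨i, a, hx⟩ := hs x
    exact ⟨(i, a), hx⟩
  simp at hc
  omega

open Classical Finset in
theorem sum_occ_pow {k : ℕ} (σ : Equiv.Perm (Fin k)) (j n : ℕ) :
    ∑ π : Equiv.Perm (Fin n), (occ σ π : ℚ) ^ j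
      = n.factorial * ∑ m ∈ range (n + 1), n.choose m * coverCoeff σ j m := by
  let c (h : Fin j → Fin k → Fin n) : ℚ :=
    ∑ π : Equiv.Perm (Fin n), if AllOcc σ h (fun a b => π a < π b) then 1 else 0
  have fiber (S : Finset (Fin n)) :
      ∑ h : Fin j → Fin k → Fin n with (univ.image fun p : Fin j × Fin k => h p.1 p.2) = S, c h
        = n.factorial * coverCoeff σ j #S := by
    let e := S.orderEmbOfFin rfl
    rw [coverCoeff, mul_div_assoc', mul_sum, sum_div]
    symm
    refine sum_bij (fun h _ i a => e (h i a)) ?_ ?_ ?_ ?_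
    · intro h hh
      simp only [mem_filter, mem_univ, true_and] at hh ⊢
      ext x
      simp only [mem_image, mem_univ, true_and, Prod.exists]
      constructor
      · rintro ⟨i, a, rfl⟩
        exact S.orderEmbOfFin_mem rfl _
      · intro hx
        obtain ⟨y, rfl⟩ : x ∈ Set.range e := by simpa [e] using hx
        obtain ⟨i, a, rfl⟩ := hh y
        exact ⟨i, a, rfl⟩
    · intro h _ h' _ heq
      funext i a
      exact e.injective (congrFun (congrFun heq i) a)
    · intro g hg
      simp only [mem_filter, mem_univ, true_and] at hg
      have hr (i a) : g i a ∈ Set.range e := by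
        simp only [e, range_orderEmbOfFin]
        rw [← hg]
        exact mem_coe.2 (mem_image_of_mem (fun p : Fin j × Fin k => g p.1 p.2) (mem_univ (i, a)))
      choose h hh using hr
      refine ⟨h, ?_, by funext i a; exact hh i a⟩
      simp only [mem_filter, mem_univ, true_and]
      intro x
      have hx : e x ∈ univ.image fun p : Fin j × Fin k => g p.1 p.2 := by
        rw [hg]
        exact S.orderEmbOfFin_mem rfl x
      simp only [mem_image, mem_univ, true_and, Prod.exists] at hx
      obtain ⟨i, a, hx⟩ := hx
      exact ⟨i, a, e.injective ((hh i a).trans hx)⟩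
    · intro h _
      rw [div_eq_iff (by positivity), mul_comm (c _),
        ← sum_perm_comp_embedding e.toEmbedding fun r => if AllOcc σ h r then (1 : ℚ) else 0]
      have he (π : Equiv.Perm (Fin n)) : AllOcc σ (fun i a => e (h i a)) (fun a b => π a < π b)
          ↔ AllOcc σ h fun a b => π (e a) < π (e b) := by simp [AllOcc]
      simp only [c, he, RelEmbedding.coe_toEmbedding]
  simp_rw [occ_pow]
  rw [sum_comm]
  change ∑ h, c h = _
  rw [← sum_fiberwise univ
    (fun h : Fin j → Fin k → Fin n => univ.image fun p : Fin j × Fin k => h p.1 p.2)]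
  have := sum_powerset_apply_card (x := (univ : Finset (Fin n)))
    fun m => (n.factorial : ℚ) * coverCoeff σ j m
  rw [powerset_univ] at this
  rw [sum_congr rfl fun S _ => fiber S, this, mul_sum, card_univ, Fintype.card_fin]
  refine sum_congr rfl fun m _ => ?_
  rw [nsmul_eq_mul]
  ring

/-- The `j`-th moment is a polynomial in `n` of degree at most `j * k`. -/
theorem sum_occ_pow_eq {k : ℕ} (σ : Equiv.Perm (Fin k)) (j n : ℕ) :
    ∑ π : Equiv.Perm (Fin n), (occ σ π : ℚ) ^ j
      = n.factorial * ∑ m ∈ Finset.range (j * k + 1), n.choose m * coverCoeff σ j m := by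
  rw [sum_occ_pow]
  congr 1
  rcases le_total n (j * k) with h | h
  · refine Finset.sum_subset (Finset.range_subset_range.2 (by omega)) fun m _ hm => ?_
    rw [Nat.choose_eq_zero_of_lt (by simpa using hm)]
    simp
  · symm
    refine Finset.sum_subset (Finset.range_subset_range.2 (by omega)) fun m _ hm => ?_
    rw [coverCoeff_eq_zero σ (by simpa using hm), mul_zero]

theorem occ_p132 {n : ℕ} (π : Equiv.Perm (Fin n)) : occ p132 π =
    ∑ i : Fin n, ∑ j : Fin n, ∑ k : Fin n,
      if i < j ∧ j < k ∧ π i < π k ∧ π k < π j then 1 else 0 := by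
  rw [occ, Finset.card_filter]
  simp_rw [← Fintype.sum_prod_type']
  symm
  refine Fintype.sum_bijective (fun x : Fin n × Fin n × Fin n => ![x.1, x.2.1, x.2.2]) ?_ _ _ ?_
  · refine ⟨fun x y h => ?_, fun f => ⟨(f 0, f 1, f 2), ?_⟩⟩
    · simpa [Prod.ext_iff] using h
    · funext i
      fin_cases i <;> rfl
  · rintro ⟨i, j, k⟩
    have h0 : p132 0 = 0 := by decide
    have h1 : p132 1 = 2 := by decide
    have h2 : p132 2 = 1 := by decide
    congr 1
    simp only [Fin.forall_fin_succ, IsEmpty.forall_iff]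
    simp [h0, h1, h2]
    grind

theorem sum_occ_p132_three : ∑ π : Equiv.Perm (Fin 3), occ p132 π = 1 := by
  simp_rw [occ_p132]
  decide +kernel

theorem sum_occ_p132_sq_three : ∑ π : Equiv.Perm (Fin 3), occ p132 π ^ 2 = 1 := by
  simp_rw [occ_p132]
  decide +kernel

theorem sum_occ_p132_sq_four : ∑ π : Equiv.Perm (Fin 4), occ p132 π ^ 2 = 30 := by
  simp_rw [occ_p132]
  decide +kernel

theorem sum_occ_p132_sq_five : ∑ π : Equiv.Perm (Fin 5), occ p132 π ^ 2 = 664 := by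
  simp_rw [occ_p132]
  decide +kernel

theorem sum_occ_p132_sq_six : ∑ π : Equiv.Perm (Fin 6), occ p132 π ^ 2 = 13204 := by
  simp_rw [occ_p132]
  decide +kernel

theorem occ_eq_zero {k n : ℕ} (σ : Equiv.Perm (Fin k)) (π : Equiv.Perm (Fin n)) (h : n < k) :
    occ σ π = 0 := by
  rw [occ, Finset.card_eq_zero, Finset.filter_eq_empty_iff]
  rintro f - ⟨hf, -⟩
  have := Fintype.card_le_of_injective f (StrictMono.injective fun a b => hf a b)
  simp at this
  omega

theorem sum_occ_pow_eq_zero {k n : ℕ} (σ : Equiv.Perm (Fin k)) {j : ℕ} (hj : j ≠ 0) (h : n < k) :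
    ∑ π : Equiv.Perm (Fin n), (occ σ π : ℚ) ^ j = 0 :=
  Finset.sum_eq_zero fun π _ => by simp [occ_eq_zero σ π h, hj]

theorem coverCoeff_eq_zero_of_lt {k m : ℕ} (σ : Equiv.Perm (Fin k)) {j : ℕ} (hj : j ≠ 0)
    (h : m < k) : coverCoeff σ j m = 0 := by
  induction m using Nat.strong_induction_on with
  | _ m ih =>
    have hs := sum_occ_pow σ j m
    rw [sum_occ_pow_eq_zero σ hj h, Finset.sum_range_succ, Finset.sum_eq_zero fun i hi => by
      have hi := Finset.mem_range.1 hi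
      rw [ih i hi (hi.trans h), mul_zero]] at hs
    simpa [Nat.factorial_ne_zero] using hs.symm

theorem sum_occ_p132 (n : ℕ) :
    ∑ π : Equiv.Perm (Fin n), (occ p132 π : ℚ) = n.factorial * (n.choose 3 / 6) := by
  have z (m : ℕ) (hm : m < 3) : coverCoeff p132 1 m = 0 :=
    coverCoeff_eq_zero_of_lt _ one_ne_zero hm
  have s (n : ℕ) : ∑ π : Equiv.Perm (Fin n), (occ p132 π : ℚ)
      = n.factorial * (n.choose 3 * coverCoeff p132 1 3) := by
    simpa [Finset.sum_range_succ, z] using sum_occ_pow_eq p132 1 n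
  have h3 := s 3
  rw [← Nat.cast_sum, sum_occ_p132_three] at h3
  norm_num [Nat.factorial] at h3
  rw [s, show coverCoeff p132 1 3 = 1 / 6 by linarith]
  ring

theorem sum_occ_p132_sq (n : ℕ) :
    ∑ π : Equiv.Perm (Fin n), (occ p132 π : ℚ) ^ 2 = n.factorial *
      (n.choose 3 / 6 + n.choose 4 * (7 / 12) + n.choose 5 * (19 / 20) + n.choose 6 * (5 / 9)) := by
  have z (m : ℕ) (hm : m < 3) : coverCoeff p132 2 m = 0 :=
    coverCoeff_eq_zero_of_lt _ two_ne_zero hm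
  have s (n : ℕ) : ∑ π : Equiv.Perm (Fin n), (occ p132 π : ℚ) ^ 2
      = n.factorial * (n.choose 3 * coverCoeff p132 2 3 + n.choose 4 * coverCoeff p132 2 4
        + n.choose 5 * coverCoeff p132 2 5 + n.choose 6 * coverCoeff p132 2 6) := by
    simpa [Finset.sum_range_succ, z] using sum_occ_pow_eq p132 2 n
  have cast (n : ℕ) : ∑ π : Equiv.Perm (Fin n), (occ p132 π : ℚ) ^ 2
      = (∑ π : Equiv.Perm (Fin n), occ p132 π ^ 2 : ℕ) := by push_cast; rfl
  have h3 := s 3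
  have h4 := s 4
  have h5 := s 5
  have h6 := s 6
  rw [cast, sum_occ_p132_sq_three] at h3
  rw [cast, sum_occ_p132_sq_four] at h4
  rw [cast, sum_occ_p132_sq_five] at h5
  rw [cast, sum_occ_p132_sq_six] at h6
  norm_num [Nat.factorial, Nat.choose] at h3 h4 h5 h6
  have c3 : coverCoeff p132 2 3 = 1 / 6 := by linarith
  rw [c3] at h4 h5 h6
  have c4 : coverCoeff p132 2 4 = 7 / 12 := by linarith
  rw [c4] at h5 h6
  have c5 : coverCoeff p132 2 5 = 19 / 20 := by linarith
  rw [c5] at h6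
  have c6 : coverCoeff p132 2 6 = 5 / 9 := by linarith
  rw [s, c3, c4, c5, c6]
  ring

theorem stmt3 (n : ℕ) (hn : 1 ≤ n) :
    (1 / (n.factorial : ℚ)) * ∑ π : Equiv.Perm (Fin n),
        ((occ p132 π : ℚ) - (n.choose 3 : ℚ) / 6) ^ 2
      = (n : ℚ) * ((n : ℚ) - 1) * ((n : ℚ) - 2)
        * (21 * (n : ℚ) ^ 2 + 78 * (n : ℚ) + 77) / 21600 := by
  have hf : (n.factorial : ℚ) ≠ 0 := by positivity
  simp_rw [sub_sq, Finset.sum_add_distrib, Finset.sum_sub_distrib, ← Finset.sum_mul,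
    ← Finset.mul_sum, sum_occ_p132, sum_occ_p132_sq]
  simp only [Finset.sum_const, Finset.card_univ, Fintype.card_perm, Fintype.card_fin, nsmul_eq_mul,
    Nat.cast_choose_eq_descPochhammer_div, descPochhammer_succ_eval, descPochhammer_zero]
  field_simp
  norm_num [Nat.factorial]
  ring
end

section
/- For n ≥ 1 define the polynomial P_n(t; x_1, …, x_n) := ∑_{π ∈ S_n} t^{N_{123}(π)} · ∏_{i=1}^n x_i^{c_i(π)}, where c_i(π) := #{(a,b) : 1 ≤ a < b ≤ n, π(a) = i and π(b) > i}. Then for every n ≥ 2, P_n(t; x_1, …, x_n) = ∑_{i=1}^n x_i^{n−i} · P_{n−1}(t; x_1, …, x_{i−1}, t·x_{i+1}, …, t·x_n). -/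
open MvPolynomial

/-- The number of occurrences of the pattern 123 in `π`. -/
def N123 {n : ℕ} (π : Equiv.Perm (Fin n)) : ℕ := occ (1 : Equiv.Perm (Fin 3)) π

/-- `c_i(π) = #{(a,b) : a < b, π(a) = i, π(b) > i}`. -/
def cexp {n : ℕ} (π : Equiv.Perm (Fin n)) (i : Fin n) : ℕ :=
  (Finset.univ.filter (fun ab : Fin n × Fin n =>
    ab.1 < ab.2 ∧ π ab.1 = i ∧ i < π ab.2)).card

/-- The polynomial `P_n(t; x_1, …, x_n) = ∑_{π ∈ S_n} t^{N_{123}(π)} ∏_i x_i^{c_i(π)}`,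
with `t = X none` and `x_{i+1} = X (some i)` (0-indexed `i : Fin n`). -/
noncomputable def P (n : ℕ) : MvPolynomial (Option (Fin n)) ℚ :=
  ∑ π : Equiv.Perm (Fin n),
    (X none) ^ (N123 π) * ∏ i : Fin n, (X (some i)) ^ (cexp π i)

/-- The substitution `t ↦ t`, `x_j ↦ x_j` for `j < i` (0-indexed), and `x_j ↦ t·x_{j+1}`
for `j ≥ i`, sending the variables of `P_n` into those of `P_{n+1}`. -/
noncomputable def substMap (n : ℕ) (i : Fin (n + 1)) :
    Option (Fin n) → MvPolynomial (Option (Fin (n + 1))) ℚ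
  | none => X none
  | some j =>
      if (j : ℕ) < (i : ℕ) then X (some (Fin.castSucc j))
      else X none * X (some j.succ)

/-- The permutation of `Fin (n + 1)` sending `0` to `i` whose remaining values form the pattern
`σ`. -/
def insertFirst {n : ℕ} (i : Fin (n + 1)) (σ : Equiv.Perm (Fin n)) : Equiv.Perm (Fin (n + 1)) :=
  ((finSuccEquiv' 0).trans (Equiv.optionCongr σ)).trans (finSuccEquiv' i).symm

@[simp]
lemma insertFirst_zero {n : ℕ} (i : Fin (n + 1)) (σ : Equiv.Perm (Fin n)) :
    insertFirst i σ 0 = i := by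
  simp [insertFirst]

@[simp]
lemma insertFirst_succ {n : ℕ} (i : Fin (n + 1)) (σ : Equiv.Perm (Fin n)) (k : Fin n) :
    insertFirst i σ k.succ = i.succAbove (σ k) := by
  have h : finSuccEquiv' (0 : Fin (n + 1)) k.succ = some k := by
    simp
  simp [insertFirst, h]

lemma insertFirst_bijective (n : ℕ) :
    Function.Bijective
      (fun p : Fin (n + 1) × Equiv.Perm (Fin n) => insertFirst p.1 p.2) := by
  rw [Fintype.bijective_iff_injective_and_card]
  constructor
  · rintro ⟨i, σ⟩ ⟨j, τ⟩ h
    have hij : i = j := by simpa using congrArg (fun π : Equiv.Perm _ => π 0) h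
    subst hij
    congr 1
    ext1 k
    have hk := congrArg (fun π : Equiv.Perm _ => π k.succ) h
    simpa using hk
  · simp [Fintype.card_perm, Nat.factorial_succ]

lemma cexp_eq_sum {n : ℕ} (π : Equiv.Perm (Fin n)) (i : Fin n) :
    cexp π i = ∑ a, if π a = i then ∑ b, if a < b ∧ π a < π b then 1 else 0 else 0 := by
  rw [cexp, Finset.card_filter, Fintype.sum_prod_type]
  refine Finset.sum_congr rfl fun a _ => ?_
  split_ifs with h
  · subst h
    simp
  · simp [h]

lemma N123_eq_sum {n : ℕ} (π : Equiv.Perm (Fin n)) :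
    N123 π = ∑ a, ∑ b, ∑ c,
      if a < b ∧ b < c ∧ π a < π b ∧ π b < π c then 1 else 0 := by
  have h : N123 π = (Finset.univ.filter (fun p : Fin n × Fin n × Fin n =>
      p.1 < p.2.1 ∧ p.2.1 < p.2.2 ∧ π p.1 < π p.2.1 ∧ π p.2.1 < π p.2.2)).card := by
    rw [N123, occ]
    refine Finset.card_bij' (fun f _ => (f 0, f 1, f 2)) (fun p _ => ![p.1, p.2.1, p.2.2])
      ?_ ?_ ?_ ?_
    · intro f hf
      obtain ⟨hpos, hval⟩ := (Finset.mem_filter.1 hf).2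
      exact Finset.mem_filter.2 ⟨Finset.mem_univ _, hpos 0 1 (by decide), hpos 1 2 (by decide),
        (hval 0 1).2 (by decide), (hval 1 2).2 (by decide)⟩
    · rintro ⟨a, b, c⟩ hp
      simp only [Finset.mem_filter, Finset.mem_univ, true_and, Equiv.Perm.one_apply] at hp ⊢
      obtain ⟨h1, h2, h3, h4⟩ := hp
      have h5 := h1.trans h2
      have h6 := h3.trans h4
      simp [Fin.forall_fin_succ, h1, h2, h3, h4, h5, h6, h3.le, h4.le, h6.le]
    · intro f _
      ext k
      fin_cases k <;> rfl
    · intro p _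
      rfl
  rw [h, Finset.card_filter, Fintype.sum_prod_type]
  simp only [Fintype.sum_prod_type]

lemma cexp_insertFirst_self {n : ℕ} (i : Fin (n + 1)) (σ : Equiv.Perm (Fin n)) :
    cexp (insertFirst i σ) i = n - i := by
  simp only [cexp_eq_sum, Fin.sum_univ_succ, insertFirst_zero, insertFirst_succ,
    Fin.succAbove_ne, if_true, if_false, lt_irrefl, false_and, Fin.succ_pos, true_and,
    Finset.sum_const_zero, zero_add, add_zero]
  rw [Equiv.sum_comp σ (fun k => if i < i.succAbove k then 1 else 0)]
  have h := Fin.sum_univ_succAbove (fun k => if i < k then 1 else 0) i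
  simp only [lt_irrefl, if_false, zero_add] at h
  rw [← h, ← Finset.card_filter, Finset.filter_lt_eq_Ioi, Fin.card_Ioi]
  omega

lemma cexp_insertFirst_succAbove {n : ℕ} (i : Fin (n + 1)) (σ : Equiv.Perm (Fin n))
    (j : Fin n) : cexp (insertFirst i σ) (i.succAbove j) = cexp σ j := by
  simp [cexp_eq_sum, Fin.sum_univ_succ, (Fin.succAbove_ne i j).symm, -Finset.sum_boole]

lemma sum_cexp_of_le {n : ℕ} (σ : Equiv.Perm (Fin n)) (i : Fin (n + 1)) :
    ∑ j : Fin n, (if (j : ℕ) < i then 0 else cexp σ j) =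
      ∑ a, ∑ b, if a < b ∧ i < i.succAbove (σ a) ∧ σ a < σ b then 1 else 0 := by
  have h (j : Fin n) : (if (j : ℕ) < i then 0 else cexp σ j) =
      ∑ a, if σ a = j then
        (if (j : ℕ) < i then 0 else ∑ b, if a < b ∧ σ a < σ b then 1 else 0) else 0 := by
    rw [cexp_eq_sum]
    split_ifs <;> simp
  simp only [h]
  rw [Finset.sum_comm]
  refine Finset.sum_congr rfl fun a _ => ?_
  rw [Finset.sum_ite_eq, if_pos (Finset.mem_univ _)]
  have hlt : i < i.succAbove (σ a) ↔ ¬ ((σ a : Fin n) : ℕ) < i := by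
    rw [Fin.lt_succAbove_iff_le_castSucc, Fin.le_def, not_lt, Fin.val_castSucc]
  simp only [hlt]
  split_ifs with h' <;> simp [h']

lemma N123_insertFirst {n : ℕ} (i : Fin (n + 1)) (σ : Equiv.Perm (Fin n)) :
    N123 (insertFirst i σ) =
      N123 σ + ∑ j : Fin n, (if (j : ℕ) < i then 0 else cexp σ j) := by
  rw [sum_cexp_of_le]
  rw [add_comm (N123 σ)]
  simp only [N123_eq_sum, Fin.sum_univ_succ (n := n), insertFirst_zero, insertFirst_succ,
    Fin.succ_lt_succ_iff, Fin.succAbove_lt_succAbove_iff, Fin.not_lt_zero, Fin.succ_pos,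
    false_and, and_false, true_and, if_false, Finset.sum_const_zero, zero_add]

lemma substMap_some (n : ℕ) (i : Fin (n + 1)) (j : Fin n) :
    substMap n i (some j) =
      X none ^ (if (j : ℕ) < i then 0 else 1) * X (some (i.succAbove j)) := by
  rw [substMap]
  split_ifs with h
  · rw [Fin.succAbove_of_castSucc_lt _ _ (Fin.lt_def.2 h), pow_zero, one_mul]
  · rw [Fin.succAbove_of_le_castSucc _ _ (Fin.le_def.2 (not_lt.1 h)), pow_one]

/-- The functional equation (FE123): for `n+1 ≥ 2`,
`P_{n+1}(t; x_1,…,x_{n+1}) = ∑_{i=1}^{n+1} x_i^{n+1-i} ·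
P_n(t; x_1,…,x_{i-1}, t x_{i+1},…, t x_{n+1})`. -/
theorem stmt9 (n : ℕ) (hn : 1 ≤ n) :
    P (n + 1) = ∑ i : Fin (n + 1),
      (X (some i)) ^ (n - (i : ℕ)) * aeval (substMap n i) (P n) := by
  rw [P, P, ← (insertFirst_bijective n).sum_comp, Fintype.sum_prod_type]
  refine Finset.sum_congr rfl fun i _ => ?_
  rw [map_sum, Finset.mul_sum]
  refine Finset.sum_congr rfl fun σ _ => ?_
  have hnone : substMap n i none = X none := rfl
  simp only [Fin.prod_univ_succAbove _ i, cexp_insertFirst_self, cexp_insertFirst_succAbove,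
    N123_insertFirst, map_mul, map_pow, map_prod, aeval_X, hnone, substMap_some, mul_pow,
    Finset.prod_mul_distrib, ← pow_mul, ite_mul, zero_mul, one_mul, Finset.prod_pow_eq_pow_sum,
    pow_add]
  ring
end

section
/- Let k, ℓ ≥ 1, σ ∈ S_k, and τ ∈ S_ℓ. Then Σ_{σ,τ} := ∫₀¹∫₀¹ G_σ(x,y)·G_τ(x,y) dx dy equals ∑_{i=1}^k ∑_{j=1}^ℓ (1/((k+ℓ−1)!)²)·binom(i+j−2, i−1)·binom(k+ℓ−i−j, k−i)·binom(σ(i)+τ(j)−2, σ(i)−1)·binom(k+ℓ−σ(i)−τ(j), k−σ(i)) − 1/(k!·(k−1)!·ℓ!·(ℓ−1)!). -/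
/-- `g_{k,i}(x) = C(k-1, i-1) x^{i-1} (1-x)^{k-i}`. -/
noncomputable def g (k i : ℕ) (x : ℝ) : ℝ :=
  ((k - 1).choose (i - 1) : ℝ) * x ^ (i - 1) * (1 - x) ^ (k - i)

/-- `G_σ(x,y) = (1/((k-1)!)²)·(∑_{i=1}^k g_{k,i}(x)·g_{k,σ(i)}(y) − 1/k)`
(with `i, σ(i)` one-indexed). -/
noncomputable def G {k : ℕ} (σ : Equiv.Perm (Fin k)) (x y : ℝ) : ℝ :=
  (1 / ((k - 1).factorial : ℝ) ^ 2) *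
    (∑ i : Fin k, g k ((i : ℕ) + 1) x * g k (((σ i : Fin k) : ℕ) + 1) y - 1 / (k : ℝ))

open intervalIntegral in
/-- The Beta integral at natural-number exponents. -/
theorem integral_pow_mul_one_sub_pow (a b : ℕ) :
    ∫ x in (0 : ℝ)..1, x ^ a * (1 - x) ^ b
      = (a.factorial : ℝ) * b.factorial / (a + b + 1).factorial := by
  induction b generalizing a with
  | zero =>
    simp only [pow_zero, mul_one, integral_pow, Nat.factorial_zero, Nat.cast_one, add_zero,
      Nat.factorial_succ]
    have : (a.factorial : ℝ) ≠ 0 := by positivity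
    push_cast
    field_simp
    simp
  | succ b ih =>
    have hderiv (x : ℝ) : HasDerivAt (fun x : ℝ => x ^ (a + 1) * (1 - x) ^ (b + 1))
        ((a + 1) * (x ^ a * (1 - x) ^ (b + 1)) - (b + 1) * (x ^ (a + 1) * (1 - x) ^ b)) x := by
      refine ((hasDerivAt_pow (a + 1) x).mul
        (((hasDerivAt_id' x).const_sub 1).fun_pow (b + 1))).congr_deriv ?_
      push_cast
      ring
    have hftc := integral_eq_sub_of_hasDerivAt (a := 0) (b := 1) (fun x _ => hderiv x)
      (by apply Continuous.intervalIntegrable; fun_prop)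
    rw [integral_sub (by apply Continuous.intervalIntegrable; fun_prop)
      (by apply Continuous.intervalIntegrable; fun_prop), integral_const_mul,
      integral_const_mul, ih] at hftc
    simp only [sub_self, sub_zero, ne_eq, Nat.add_eq_zero_iff, one_ne_zero, and_false,
      not_false_eq_true, zero_pow, mul_zero, zero_mul, sub_eq_zero] at hftc
    have ha : (a + 1 : ℝ) ≠ 0 := by positivity
    apply mul_left_cancel₀ ha
    rw [hftc, show a + 1 + b + 1 = a + (b + 1) + 1 by ring, Nat.factorial_succ a,
      Nat.factorial_succ b]
    push_cast
    ring

theorem continuous_g (k i : ℕ) : Continuous (g k i) := by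
  unfold g
  fun_prop

theorem integral_g_mul_g {k l i j : ℕ} (hi : i < k) (hj : j < l) :
    ∫ x in (0 : ℝ)..1, g k (i + 1) x * g l (j + 1) x
      = ((k - 1).factorial : ℝ) * (l - 1).factorial / (k + l - 1).factorial
        * ((i + 1 + (j + 1) - 2).choose (i + 1 - 1) : ℝ)
        * ((k + l - (i + 1) - (j + 1)).choose (k - (i + 1)) : ℝ) := by
  obtain ⟨a, rfl⟩ := Nat.exists_eq_add_of_lt hi
  obtain ⟨b, rfl⟩ := Nat.exists_eq_add_of_lt hj
  have hg (x : ℝ) : g (i + a + 1) (i + 1) x * g (j + b + 1) (j + 1) x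
      = ((i + a).choose i * (j + b).choose j : ℝ) * (x ^ (i + j) * (1 - x) ^ (a + b)) := by
    simp only [g, Nat.add_sub_cancel, show i + a + 1 - (i + 1) = a by lia,
      show j + b + 1 - (j + 1) = b by lia]
    ring
  simp_rw [hg]
  rw [intervalIntegral.integral_const_mul, integral_pow_mul_one_sub_pow]
  simp only [Nat.add_sub_cancel, show i + a + 1 - (i + 1) = a by lia,
    show i + 1 + (j + 1) - 2 = i + j by lia,
    show i + a + 1 + (j + b + 1) - (i + 1) - (j + 1) = a + b by lia,
    show i + a + 1 + (j + b + 1) - 1 = i + j + (a + b) + 1 by lia, Nat.cast_add_choose]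
  have (n : ℕ) : (n.factorial : ℝ) ≠ 0 := by positivity
  field_simp [this]

theorem integral_g {k i : ℕ} (hi : i < k) :
    ∫ x in (0 : ℝ)..1, g k (i + 1) x = 1 / k := by
  have h := integral_g_mul_g hi zero_lt_one
  have hfac : (k.factorial : ℝ) = k * (k - 1).factorial :=
    mod_cast (Nat.mul_factorial_pred (by lia)).symm
  have : ((k - 1).factorial : ℝ) ≠ 0 := by positivity
  have : (k : ℝ) ≠ 0 := by norm_cast; lia
  simp only [Nat.add_sub_cancel, show i + 1 + (0 + 1) - 2 = i by lia,
    show k + 1 - (i + 1) - (0 + 1) = k - (i + 1) by lia, Nat.choose_self, hfac] at h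
  simp only [g, Nat.add_sub_cancel] at h ⊢
  simp only [Nat.sub_self, zero_add, Nat.choose_self, pow_zero, mul_one, Nat.cast_one,
    Nat.factorial_zero] at h
  rw [h]
  field_simp

open intervalIntegral in
theorem integral_integral_sum_mul_sum {ι κ : Type*} [Fintype ι] [Fintype κ]
    {p q : ι → ℝ → ℝ} {r s : κ → ℝ → ℝ} (hp : ∀ i, Continuous (p i))
    (hq : ∀ i, Continuous (q i)) (hr : ∀ j, Continuous (r j)) (hs : ∀ j, Continuous (s j))
    (a b c d : ℝ) :
    ∫ x in a..b, ∫ y in c..d, (∑ i, p i x * q i y) * ∑ j, r j x * s j y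
      = ∑ i, ∑ j, (∫ x in a..b, p i x * r j x) * ∫ y in c..d, q i y * s j y := by
  have hinner (x : ℝ) : ∫ y in c..d, (∑ i, p i x * q i y) * ∑ j, r j x * s j y
      = ∑ i, ∑ j, p i x * r j x * ∫ y in c..d, q i y * s j y := by
    have hterm (i : ι) (j : κ) (y : ℝ) :
        p i x * q i y * (r j x * s j y) = p i x * r j x * (q i y * s j y) := by
      ring
    simp_rw [Finset.sum_mul_sum, hterm]
    rw [integral_finsetSum fun i _ => by apply Continuous.intervalIntegrable; fun_prop]
    refine Finset.sum_congr rfl fun i _ => ?_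
    rw [integral_finsetSum fun j _ => by apply Continuous.intervalIntegrable; fun_prop]
    simp_rw [integral_const_mul]
  simp_rw [hinner]
  rw [integral_finsetSum fun i _ => by apply Continuous.intervalIntegrable; fun_prop]
  refine Finset.sum_congr rfl fun i _ => ?_
  rw [integral_finsetSum fun j _ => by apply Continuous.intervalIntegrable; fun_prop]
  simp_rw [integral_mul_const]

theorem integral_integral_sum_g_sub_mul {k l : ℕ} (hk : 1 ≤ k) (hl : 1 ≤ l)
    (σ : Equiv.Perm (Fin k)) (τ : Equiv.Perm (Fin l)) :
    ∫ x in (0 : ℝ)..1, ∫ y in (0 : ℝ)..1,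
        (∑ i : Fin k, g k ((i : ℕ) + 1) x * g k ((σ i : ℕ) + 1) y - 1 / (k : ℝ))
          * (∑ j : Fin l, g l ((j : ℕ) + 1) x * g l ((τ j : ℕ) + 1) y - 1 / (l : ℝ))
      = (∑ i : Fin k, ∑ j : Fin l,
          (∫ x in (0 : ℝ)..1, g k ((i : ℕ) + 1) x * g l ((j : ℕ) + 1) x)
            * ∫ y in (0 : ℝ)..1, g k ((σ i : ℕ) + 1) y * g l ((τ j : ℕ) + 1) y)
        - 1 / (k * l : ℝ) := by
  have hsub (n : ℕ) (ρ : Equiv.Perm (Fin n)) (x y : ℝ) :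
      ∑ i : Fin n, g n ((i : ℕ) + 1) x * g n ((ρ i : ℕ) + 1) y - 1 / (n : ℝ)
        = ∑ o : Option (Fin n), (o.elim (fun _ => 1) fun i => g n ((i : ℕ) + 1) : ℝ → ℝ) x
            * (o.elim (fun _ => -1 / (n : ℝ)) fun i => g n ((ρ i : ℕ) + 1) : ℝ → ℝ) y := by
    simp only [Fintype.sum_option, Option.elim]
    ring
  have hk' : (k : ℝ) ≠ 0 := by norm_cast; lia
  have hl' : (l : ℝ) ≠ 0 := by norm_cast; lia
  simp_rw [hsub]
  rw [integral_integral_sum_mul_sum]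
  · simp only [Fintype.sum_option, Option.elim, Finset.sum_add_distrib, one_mul, mul_one,
      intervalIntegral.integral_const_mul, intervalIntegral.integral_mul_const,
      intervalIntegral.integral_const, integral_g, Fin.is_lt, Finset.sum_const,
      Finset.card_univ, Fintype.card_fin, nsmul_eq_mul, sub_zero, smul_eq_mul]
    field_simp
    ring
  all_goals
    rintro (_ | i)
    · exact continuous_const
    · exact continuous_g _ _

/-- Explicit formula for `Σ_{σ,τ} = ∫₀¹∫₀¹ G_σ(x,y) G_τ(x,y) dx dy`, where the indices
`i, j, σ(i), τ(j)` in the binomial coefficients are one-indexed (so `i` corresponds to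
`(i : ℕ) + 1` for `i : Fin k`, etc.). -/
theorem stmt12 (k l : ℕ) (hk : 1 ≤ k) (hl : 1 ≤ l)
    (σ : Equiv.Perm (Fin k)) (τ : Equiv.Perm (Fin l)) :
    (∫ x in (0:ℝ)..1, ∫ y in (0:ℝ)..1, G σ x y * G τ x y)
      = (∑ i : Fin k, ∑ j : Fin l,
          (1 / ((k + l - 1).factorial : ℝ) ^ 2)
          * (Nat.choose (((i : ℕ) + 1) + ((j : ℕ) + 1) - 2) (((i : ℕ) + 1) - 1) : ℝ)
          * (Nat.choose (k + l - ((i : ℕ) + 1) - ((j : ℕ) + 1)) (k - ((i : ℕ) + 1)) : ℝ)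
          * (Nat.choose ((((σ i : Fin k) : ℕ) + 1) + (((τ j : Fin l) : ℕ) + 1) - 2)
              ((((σ i : Fin k) : ℕ) + 1) - 1) : ℝ)
          * (Nat.choose (k + l - (((σ i : Fin k) : ℕ) + 1) - (((τ j : Fin l) : ℕ) + 1))
              (k - (((σ i : Fin k) : ℕ) + 1)) : ℝ))
        - 1 / ((k.factorial : ℝ) * ((k - 1).factorial : ℝ)
            * (l.factorial : ℝ) * ((l - 1).factorial : ℝ)) := by
  have hG (x y : ℝ) : G σ x y * G τ x y
      = 1 / ((k - 1).factorial : ℝ) ^ 2 * (1 / ((l - 1).factorial : ℝ) ^ 2)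
        * ((∑ i : Fin k, g k ((i : ℕ) + 1) x * g k ((σ i : ℕ) + 1) y - 1 / (k : ℝ))
          * (∑ j : Fin l, g l ((j : ℕ) + 1) x * g l ((τ j : ℕ) + 1) y - 1 / (l : ℝ))) := by
    unfold G
    ring
  have hkfac : (k.factorial : ℝ) = k * (k - 1).factorial :=
    mod_cast (Nat.mul_factorial_pred (by lia)).symm
  have hlfac : (l.factorial : ℝ) = l * (l - 1).factorial :=
    mod_cast (Nat.mul_factorial_pred (by lia)).symm
  have hfac (n : ℕ) : (n.factorial : ℝ) ≠ 0 := by positivity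
  have hk' : (k : ℝ) ≠ 0 := by norm_cast; lia
  have hl' : (l : ℝ) ≠ 0 := by norm_cast; lia
  simp_rw [hG, intervalIntegral.integral_const_mul]
  rw [integral_integral_sum_g_sub_mul hk hl, mul_sub, Finset.mul_sum]
  simp_rw [Finset.mul_sum]
  congr 1
  · refine Finset.sum_congr rfl fun i _ => Finset.sum_congr rfl fun j _ => ?_
    rw [integral_g_mul_g i.is_lt j.is_lt, integral_g_mul_g (σ i).is_lt (τ j).is_lt]
    have := hfac (k - 1)
    have := hfac (l - 1)
    have := hfac (k + l - 1)
    field_simp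
  · rw [hkfac, hlfac]
    have := hfac (k - 1)
    have := hfac (l - 1)
    field_simp
end

section
/- For every k ≥ 2 and every permutation σ ∈ S_k, Σ_{σ,σ} := ∫₀¹∫₀¹ G_σ(x,y)² dx dy > 0. In particular, G_σ is not identically zero on [0,1]². -/
theorem g_succ_zero (k i : ℕ) : g k (i + 1) 0 = if i = 0 then 1 else 0 := by
  by_cases h : i = 0 <;> simp [g, h]

theorem continuous_uncurry_G {k : ℕ} (σ : Equiv.Perm (Fin k)) :
    Continuous (Function.uncurry (G σ)) := by
  have h (i : ℕ) : Continuous (g k i) := continuous_g k i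
  unfold Function.uncurry G
  fun_prop

theorem G_zero_zero_ne_zero {k : ℕ} (hk : 2 ≤ k) (σ : Equiv.Perm (Fin k)) : G σ 0 0 ≠ 0 := by
  have : NeZero k := ⟨by omega⟩
  have hk' : (2 : ℝ) ≤ k := by exact_mod_cast hk
  have hpos : (0 : ℝ) < 1 / k := by positivity
  have hlt : 1 / (k : ℝ) < 1 := by
    rw [div_lt_one (by positivity)]
    linarith
  have hsum : ∑ i : Fin k, g k ((i : ℕ) + 1) 0 * g k ((σ i : ℕ) + 1) 0 =
      if (σ 0 : ℕ) = 0 then 1 else 0 := by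
    rw [Finset.sum_eq_single 0]
    · simp [g_succ_zero]
    · intro i _ hi
      simp [g_succ_zero, hi]
    · simp
  unfold G
  rw [hsum]
  refine mul_ne_zero (by positivity) ?_
  split_ifs
  · exact sub_ne_zero.mpr hlt.ne'
  · exact sub_ne_zero.mpr hpos.ne

theorem stmt13 (k : ℕ) (hk : 2 ≤ k) (σ : Equiv.Perm (Fin k)) :
    (0 < ∫ x in (0:ℝ)..1, ∫ y in (0:ℝ)..1, (G σ x y) ^ 2) ∧
      ∃ x ∈ Set.Icc (0:ℝ) 1, ∃ y ∈ Set.Icc (0:ℝ) 1, G σ x y ≠ 0 := by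
  have hG : Continuous (Function.uncurry fun x y => (G σ x y) ^ 2) :=
    (continuous_uncurry_G σ).pow 2
  have hzero : (0 : ℝ) ∈ Set.Icc (0 : ℝ) 1 := by simp
  have hne := G_zero_zero_ne_zero hk σ
  refine ⟨?_, 0, hzero, 0, hzero, hne⟩
  refine intervalIntegral.integral_pos one_pos
    (intervalIntegral.continuous_parametric_intervalIntegral_of_continuous' hG 0 1).continuousOn
    (fun x _ => intervalIntegral.integral_nonneg zero_le_one fun y _ => sq_nonneg _)
    ⟨0, hzero, ?_⟩
  exact intervalIntegral.integral_pos one_pos (hG.uncurry_left 0).continuousOn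
    (fun y _ => sq_nonneg _) ⟨0, hzero, by positivity⟩
end

section
/- For every k ≥ 1, the linear span (over ℝ) of the family of functions {G_σ : σ ∈ S_k}, viewed as elements of L²([0,1]²), has dimension (k−1)². -/
/-- The functions `g_{n+1,i}`, `1 ≤ i ≤ n+1`, form a partition of unity. -/
lemma sum_g_eq_one (n : ℕ) (x : ℝ) : ∑ i : Fin (n + 1), g (n + 1) ((i : ℕ) + 1) x = 1 := by
  have h := add_pow x (1 - x) n
  rw [add_sub_cancel, one_pow, Finset.sum_range] at h
  rw [h]
  refine Finset.sum_congr rfl fun i _ => ?_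
  simp only [g, Nat.add_sub_cancel, Nat.add_sub_add_right]
  ring

/-- A Bernstein polynomial with its power of `X` in front. -/
lemma bernsteinPolynomial_eq_X_pow_mul (n i : ℕ) : bernsteinPolynomial ℝ n i =
    Polynomial.X ^ i * ((n.choose i : Polynomial ℝ) * (1 - Polynomial.X) ^ (n - i)) := by
  rw [bernsteinPolynomial]
  ring

/-- The `i`-th Bernstein polynomial has no terms of degree less than `i`. -/
lemma coeff_bernsteinPolynomial_of_lt (n : ℕ) {i j : ℕ} (h : j < i) :
    (bernsteinPolynomial ℝ n i).coeff j = 0 := by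
  rw [bernsteinPolynomial_eq_X_pow_mul, Polynomial.coeff_X_pow_mul', if_neg (not_le.mpr h)]

/-- The lowest coefficient of the `i`-th Bernstein polynomial. -/
lemma coeff_bernsteinPolynomial_self (n i : ℕ) :
    (bernsteinPolynomial ℝ n i).coeff i = n.choose i := by
  rw [bernsteinPolynomial_eq_X_pow_mul, Polynomial.coeff_X_pow_mul', if_pos le_rfl, Nat.sub_self,
    Polynomial.coeff_zero_eq_eval_zero]
  simp

/-- The functions `g_{n+1,i}`, `1 ≤ i ≤ n+1`, are linearly independent on every infinite set. -/
lemma eq_zero_of_sum_mul_g_eq_zero (n : ℕ) {s : Set ℝ} (hs : s.Infinite) (c : Fin (n + 1) → ℝ)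
    (h : ∀ x ∈ s, ∑ i, c i * g (n + 1) ((i : ℕ) + 1) x = 0) : c = 0 := by
  have hp : ∑ i, c i • bernsteinPolynomial ℝ n (i : ℕ) = 0 := by
    refine Polynomial.eq_zero_of_infinite_isRoot _ (hs.mono fun x hx => ?_)
    simpa [Polynomial.IsRoot, Polynomial.eval_finsetSum, bernsteinPolynomial, g,
      Nat.add_sub_add_right] using h x hx
  ext i
  induction i using WellFoundedLT.induction with
  | ind i ih =>
    have h0 := congrArg (fun p => Polynomial.coeff p (i : ℕ)) hp
    simp only [Polynomial.finsetSum_coeff, Polynomial.coeff_smul, Polynomial.coeff_zero,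
      smul_eq_mul] at h0
    rw [Finset.sum_eq_single i, coeff_bernsteinPolynomial_self] at h0
    · exact (mul_eq_zero.mp h0).resolve_right
        (Nat.cast_ne_zero.mpr (Nat.choose_pos (Nat.lt_succ_iff.mp i.2)).ne')
    · intro j _ hj
      rcases lt_or_gt_of_ne hj with hlt | hgt
      · simp [ih j hlt]
      · rw [coeff_bernsteinPolynomial_of_lt n hgt, mul_zero]
    · simp

section PermutationSpan

variable {X : Type*} {s : Set X} {n : ℕ}

/-- The tensor product of two functions, restricted to a square. -/
def squareTensor (s : Set X) (u v : X → ℝ) (p : (s ×ˢ s : Set (X × X))) : ℝ :=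
  u p.1.1 * v p.1.2

/-- Products of linearly independent functions are linearly independent on the square. -/
lemma linearIndependent_squareTensor {ι : Type*} [Fintype ι] (u : ι → X → ℝ)
    (hu : ∀ c : ι → ℝ, (∀ x ∈ s, ∑ i, c i * u i x = 0) → c = 0) :
    LinearIndependent ℝ (fun q : ι × ι => squareTensor s (u q.1) (u q.2)) := by
  rw [Fintype.linearIndependent_iff]
  rintro A hA ⟨i, j⟩
  refine congrFun (hu (fun j => A (i, j)) fun y hy => ?_) j
  refine congrFun (hu (fun i => ∑ j, A (i, j) * u j y) fun x hx => ?_) i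
  have h := congrFun hA ⟨(x, y), hx, hy⟩
  simp only [Finset.sum_apply, Pi.smul_apply, smul_eq_mul, squareTensor, Pi.zero_apply,
    Fintype.sum_prod_type] at h
  rw [← h]
  refine Finset.sum_congr rfl fun i _ => ?_
  rw [Finset.sum_mul]
  exact Finset.sum_congr rfl fun j _ => by ring

/-- Functions that sum to zero and are permuted against each other generate all their products. -/
lemma span_sum_squareTensor_perm (v : Fin (n + 1) → X → ℝ) (hv : ∀ x, ∑ i, v i x = 0) :
    Submodule.span ℝ (Set.range fun σ : Equiv.Perm (Fin (n + 1)) =>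
        ∑ i, squareTensor s (v i) (v (σ i))) =
      Submodule.span ℝ (Set.range fun q : Fin n × Fin n =>
        squareTensor s (v q.1.succ) (v q.2.succ)) := by
  set W := Submodule.span ℝ (Set.range fun σ : Equiv.Perm (Fin (n + 1)) =>
    ∑ i, squareTensor s (v i) (v (σ i))) with hW
  set V := Submodule.span ℝ (Set.range fun q : Fin n × Fin n =>
    squareTensor s (v q.1.succ) (v q.2.succ)) with hV
  have hsum (x : X) : v 0 x = -∑ i : Fin n, v i.succ x := by
    have := hv x
    rw [Fin.sum_univ_succ] at this
    linarith
  apply le_antisymm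
  · have hss (i j : Fin n) : squareTensor s (v i.succ) (v j.succ) ∈ V :=
      Submodule.subset_span ⟨(i, j), rfl⟩
    have hs0 (i : Fin n) : squareTensor s (v i.succ) (v 0) ∈ V := by
      have : squareTensor s (v i.succ) (v 0) =
          -∑ j : Fin n, squareTensor s (v i.succ) (v j.succ) := by
        ext p
        simp [squareTensor, hsum, Finset.mul_sum]
      rw [this]
      exact V.neg_mem (V.sum_mem fun j _ => hss i j)
    have hsj (i : Fin n) (j : Fin (n + 1)) : squareTensor s (v i.succ) (v j) ∈ V := by
      cases j using Fin.cases with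
      | zero => exact hs0 i
      | succ j => exact hss i j
    have hij (i j : Fin (n + 1)) : squareTensor s (v i) (v j) ∈ V := by
      cases i using Fin.cases with
      | zero =>
        have : squareTensor s (v 0) (v j) = -∑ i : Fin n, squareTensor s (v i.succ) (v j) := by
          ext p
          simp [squareTensor, hsum p.1.1, Finset.sum_mul]
        rw [this]
        exact V.neg_mem (V.sum_mem fun i _ => hsj i j)
      | succ i => exact hsj i j
    rw [hW, Submodule.span_le]
    rintro _ ⟨σ, rfl⟩
    exact V.sum_mem fun i _ => hij _ _
  · have hdiff (a b c d : Fin (n + 1)) :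
        squareTensor s (v a - v b) (v c - v d) ∈ W := by
      by_cases hab : a = b
      · have : squareTensor s (v a - v b) (v c - v d) = 0 := by
          ext p
          simp [squareTensor, hab]
        exact this ▸ W.zero_mem
      by_cases hcd : c = d
      · have : squareTensor s (v a - v b) (v c - v d) = 0 := by
          ext p
          simp [squareTensor, hcd]
        exact this ▸ W.zero_mem
      obtain ⟨σ, hσa, hσb⟩ : ∃ σ : Equiv.Perm (Fin (n + 1)), σ a = c ∧ σ b = d := by
        refine ⟨(Equiv.swap a c).trans (Equiv.swap (Equiv.swap a c b) d), ?_, ?_⟩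
        · have : c ≠ Equiv.swap a c b := by
            intro h
            apply hab
            apply (Equiv.swap a c).injective
            rw [← h, Equiv.swap_apply_left]
          simp [Equiv.swap_apply_of_ne_of_ne this hcd]
        · simp
      have : squareTensor s (v a - v b) (v c - v d) =
          ∑ i, squareTensor s (v i) (v (σ i)) -
            ∑ i, squareTensor s (v i) (v ((σ * Equiv.swap a b) i)) := by
        rw [← Finset.sum_sub_distrib, ← Finset.sum_subset (Finset.subset_univ {a, b}),
          Finset.sum_pair hab]
        · ext p
          simp [squareTensor, hσa, hσb]
          ring
        · intro i _ hi
          simp only [Finset.mem_insert, Finset.mem_singleton, not_or] at hi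
          simp [Equiv.swap_apply_of_ne_of_ne hi.1 hi.2]
      rw [this]
      exact W.sub_mem (Submodule.subset_span ⟨_, rfl⟩) (Submodule.subset_span ⟨_, rfl⟩)
    rw [hV, Submodule.span_le]
    rintro _ ⟨⟨a, c⟩, rfl⟩
    have hne : ((n : ℝ) + 1) ^ 2 ≠ 0 := by positivity
    have : squareTensor s (v a.succ) (v c.succ) = (((n : ℝ) + 1) ^ 2)⁻¹ •
        ∑ b, ∑ d, squareTensor s (v a.succ - v b) (v c.succ - v d) := by
      rw [eq_inv_smul_iff₀ hne]
      ext p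
      simp only [Finset.sum_apply, squareTensor, Pi.smul_apply, Pi.sub_apply, smul_eq_mul,
        ← Finset.mul_sum, ← Finset.sum_mul, Finset.sum_sub_distrib, hv, Finset.sum_const,
        Finset.card_univ, Fintype.card_fin, nsmul_eq_mul]
      push_cast
      ring
    simp only [this]
    exact W.smul_mem _ (W.sum_mem fun b _ => W.sum_mem fun d _ => hdiff _ _ _ _)

open scoped Pointwise in
/-- The centred permutation sums of a linearly independent partition of unity with `n + 1` members
span a space of dimension `n ^ 2`. -/
lemma finrank_span_perm_sum (f : Fin (n + 1) → X → ℝ) (hone : ∀ x, ∑ i, f i x = 1)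
    (hf : ∀ c : Fin (n + 1) → ℝ, (∀ x ∈ s, ∑ i, c i * f i x = 0) → c = 0)
    {r : ℝ} (hr : r ≠ 0) :
    Module.finrank ℝ (Submodule.span ℝ (Set.range fun σ : Equiv.Perm (Fin (n + 1)) =>
      fun p : (s ×ˢ s : Set (X × X)) =>
        r * (∑ i, f i p.1.1 * f (σ i) p.1.2 - 1 / ((n + 1 : ℕ) : ℝ)))) = n ^ 2 := by
  have hne : (n : ℝ) + 1 ≠ 0 := by positivity
  let v : Fin (n + 1) → X → ℝ := fun i x => f i x - 1 / ((n : ℝ) + 1)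
  have hv (x : X) : ∑ i, v i x = 0 := by
    simp only [v, Finset.sum_sub_distrib, hone, Finset.sum_const, Finset.card_univ,
      Fintype.card_fin, nsmul_eq_mul]
    push_cast
    field_simp
    ring
  have hvli (c : Fin n → ℝ) (hc : ∀ x ∈ s, ∑ i, c i * v i.succ x = 0) : c = 0 := by
    set C := (∑ i, c i) / ((n : ℝ) + 1) with hC
    have h := hf (Fin.cons (-C) fun i => c i - C) fun x hx => by
      have h1 := hc x hx
      have h2 := hone x
      rw [Fin.sum_univ_succ] at h2 ⊢
      simp only [v, mul_sub, Finset.sum_sub_distrib, ← Finset.sum_mul] at h1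
      simp only [Fin.cons_zero, Fin.cons_succ, sub_mul, Finset.sum_sub_distrib,
        ← Finset.mul_sum]
      have h3 : (∑ i, c i) * (1 / ((n : ℝ) + 1)) = C := by rw [hC]; ring
      rw [h3] at h1
      linear_combination h1 - C * h2
    have hC0 : C = 0 := by simpa using congrFun h 0
    ext i
    simpa [hC0] using congrFun h i.succ
  have hG : (fun σ : Equiv.Perm (Fin (n + 1)) => fun p : (s ×ˢ s : Set (X × X)) =>
        r * (∑ i, f i p.1.1 * f (σ i) p.1.2 - 1 / ((n + 1 : ℕ) : ℝ))) =
      fun σ => r • ∑ i, squareTensor s (v i) (v (σ i)) := by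
    ext σ p
    have hσ : ∑ i, f (σ i) p.1.2 = 1 :=
      (Equiv.sum_comp σ fun i => f i p.1.2).trans (hone _)
    simp only [Pi.smul_apply, Finset.sum_apply, squareTensor, smul_eq_mul, v, mul_sub, sub_mul,
      Finset.sum_sub_distrib, ← Finset.sum_mul, ← Finset.mul_sum, hσ, hone, Finset.sum_const,
      Finset.card_univ, Fintype.card_fin, nsmul_eq_mul]
    push_cast
    field_simp
    ring
  have hrange : (Set.range fun σ : Equiv.Perm (Fin (n + 1)) =>
      r • ∑ i, squareTensor s (v i) (v (σ i))) =
      r • Set.range fun σ : Equiv.Perm (Fin (n + 1)) =>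
        ∑ i, squareTensor s (v i) (v (σ i)) := by
    rw [← Set.image_smul, ← Set.range_comp]
    rfl
  rw [hG, hrange, Submodule.span_smul_eq_of_isUnit _ _ hr.isUnit,
    span_sum_squareTensor_perm v hv,
    finrank_span_eq_card (linearIndependent_squareTensor (fun i : Fin n => v i.succ) hvli)]
  simp [sq]

end PermutationSpan

/-- The span of the functions `G_σ`, `σ ∈ S_k`, viewed as real-valued functions on the
square `[0,1]²`, has dimension `(k-1)²`. -/
theorem stmt14 (k : ℕ) (hk : 1 ≤ k) :
    Module.finrank ℝ ↥(Submodule.span ℝ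
      (Set.range (fun σ : Equiv.Perm (Fin k) =>
        fun p : (Set.Icc (0:ℝ) 1 ×ˢ Set.Icc (0:ℝ) 1 : Set (ℝ × ℝ)) => G σ p.1.1 p.1.2)))
      = (k - 1) ^ 2 := by
  obtain ⟨n, rfl⟩ := Nat.exists_eq_add_of_le' hk
  exact finrank_span_perm_sum (fun i : Fin (n + 1) => g (n + 1) ((i : ℕ) + 1)) (sum_g_eq_one n)
    (eq_zero_of_sum_mul_g_eq_zero n (Set.Icc_infinite zero_lt_one)) (by positivity)
end

section
/- Among the six patterns σ ∈ S_3, the quantity Σ_{σ,σ} := ∫₀¹∫₀¹ G_σ(x,y)² dx dy equals 13/7200 when σ is 123 or 321, and equals 7/7200 when σ is any of 132, 213, 231, 312. -/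
/-- The pattern 213 (one-line notation). -/
def p213 : Equiv.Perm (Fin 3) := Equiv.swap 0 1

/-- The pattern 231 (one-line notation): 1 ↦ 2, 2 ↦ 3, 3 ↦ 1. -/
def p231 : Equiv.Perm (Fin 3) := ⟨![1, 2, 0], ![2, 0, 1], by decide, by decide⟩

/-- The integral over `[0,1]` of a polynomial of degree at most four. -/
lemma integral_quartic (a b c d e : ℝ) :
    ∫ x in (0:ℝ)..1, (a + b * x + c * x ^ 2 + d * x ^ 3 + e * x ^ 4) =
      a + b / 2 + c / 3 + d / 4 + e / 5 := by
  have hderiv (x : ℝ) : HasDerivAt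
      (fun x : ℝ => a * x + b / 2 * x ^ 2 + c / 3 * x ^ 3 + d / 4 * x ^ 4 + e / 5 * x ^ 5)
      (a + b * x + c * x ^ 2 + d * x ^ 3 + e * x ^ 4) x := by
    refine HasDerivAt.congr_deriv ((((((hasDerivAt_id x).const_mul a).add
      ((hasDerivAt_pow 2 x).const_mul (b / 2))).add
      ((hasDerivAt_pow 3 x).const_mul (c / 3))).add ((hasDerivAt_pow 4 x).const_mul (d / 4))).add
      ((hasDerivAt_pow 5 x).const_mul (e / 5))) ?_
    norm_num
    ring
  rw [intervalIntegral.integral_eq_sub_of_hasDerivAt (fun x _ => hderiv x)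
    (Continuous.intervalIntegrable (by fun_prop) _ _)]
  ring

/-- The squared `L²` norm on `[0,1]` of a quadratic polynomial in Bernstein form. -/
lemma integral_bernstein_sq (a b c : ℝ) :
    ∫ y in (0:ℝ)..1, (a * (1 - y) ^ 2 + b * (2 * y * (1 - y)) + c * y ^ 2) ^ 2 =
      (3 * a ^ 2 + 3 * a * b + a * c + 2 * b ^ 2 + 3 * b * c + 3 * c ^ 2) / 15 := by
  have hexp (y : ℝ) : (a * (1 - y) ^ 2 + b * (2 * y * (1 - y)) + c * y ^ 2) ^ 2 =
      a ^ 2 + 4 * a * (b - a) * y + (2 * a * (a - 2 * b + c) + 4 * (b - a) ^ 2) * y ^ 2 +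
        4 * (b - a) * (a - 2 * b + c) * y ^ 3 + (a - 2 * b + c) ^ 2 * y ^ 4 := by
    ring
  simp only [hexp, integral_quartic]
  ring

/-- For a pattern `σ` of length three, integrating out `y` reduces `∫∫ G_σ²` to a single integral
of a quadratic form in the Bernstein polynomials `g_{3,σ⁻¹(j)}`. -/
lemma integral_G_sq (σ : Equiv.Perm (Fin 3)) :
    ∫ x in (0:ℝ)..1, ∫ y in (0:ℝ)..1, (G σ x y) ^ 2 =
      ∫ x in (0:ℝ)..1,
        (3 * (g 3 (σ.symm 0 + 1) x - 1 / 3) ^ 2 +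
          3 * (g 3 (σ.symm 0 + 1) x - 1 / 3) * (g 3 (σ.symm 1 + 1) x - 1 / 3) +
          (g 3 (σ.symm 0 + 1) x - 1 / 3) * (g 3 (σ.symm 2 + 1) x - 1 / 3) +
          2 * (g 3 (σ.symm 1 + 1) x - 1 / 3) ^ 2 +
          3 * (g 3 (σ.symm 1 + 1) x - 1 / 3) * (g 3 (σ.symm 2 + 1) x - 1 / 3) +
          3 * (g 3 (σ.symm 2 + 1) x - 1 / 3) ^ 2) / 240 := by
  refine intervalIntegral.integral_congr fun x _ => ?_
  have hG (y : ℝ) : G σ x y ^ 2 = 1 / 16 *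
      ((g 3 (σ.symm 0 + 1) x - 1 / 3) * (1 - y) ^ 2 +
        (g 3 (σ.symm 1 + 1) x - 1 / 3) * (2 * y * (1 - y)) +
        (g 3 (σ.symm 2 + 1) x - 1 / 3) * y ^ 2) ^ 2 := by
    have hsum : ∑ i : Fin 3, g 3 ((i : ℕ) + 1) x * g 3 ((σ i : ℕ) + 1) y =
        ∑ j : Fin 3, g 3 ((σ.symm j : ℕ) + 1) x * g 3 ((j : ℕ) + 1) y :=
      Fintype.sum_equiv σ _ _ fun i => by simp
    have h0 : g 3 1 y = (1 - y) ^ 2 := by simp [g]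
    have h1 : g 3 2 y = 2 * y * (1 - y) := by simp [g]
    have h2 : g 3 3 y = y ^ 2 := by simp [g]
    rw [G, hsum, Fin.sum_univ_three]
    simp only [Fin.val_zero, Fin.val_one, Fin.val_two, Nat.reduceAdd, h0, h1, h2]
    norm_num [Nat.factorial]
    ring
  simp only [hG, intervalIntegral.integral_const_mul, integral_bernstein_sq]
  ring

/-- The integral over `[0,1]` of a function that is a polynomial of degree at most four. -/
lemma integral_eq_of_quartic {f : ℝ → ℝ} (a b c d e : ℝ)
    (hf : ∀ x, f x = a + b * x + c * x ^ 2 + d * x ^ 3 + e * x ^ 4) :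
    ∫ x in (0:ℝ)..1, f x = a + b / 2 + c / 3 + d / 4 + e / 5 := by
  simp only [hf, integral_quartic]

theorem stmt16 :
    (∫ x in (0:ℝ)..1, ∫ y in (0:ℝ)..1, (G p123 x y) ^ 2) = 13 / 7200 ∧
    (∫ x in (0:ℝ)..1, ∫ y in (0:ℝ)..1, (G p321 x y) ^ 2) = 13 / 7200 ∧
    (∫ x in (0:ℝ)..1, ∫ y in (0:ℝ)..1, (G p132 x y) ^ 2) = 7 / 7200 ∧
    (∫ x in (0:ℝ)..1, ∫ y in (0:ℝ)..1, (G p213 x y) ^ 2) = 7 / 7200 ∧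
    (∫ x in (0:ℝ)..1, ∫ y in (0:ℝ)..1, (G p231 x y) ^ 2) = 7 / 7200 ∧
    (∫ x in (0:ℝ)..1, ∫ y in (0:ℝ)..1, (G p312 x y) ^ 2) = 7 / 7200 := by
  refine ⟨?_, ?_, ?_, ?_, ?_, ?_⟩
  · have h0 : p123.symm 0 = 0 := by decide
    have h1 : p123.symm 1 = 1 := by decide
    have h2 : p123.symm 2 = 2 := by decide
    rw [integral_G_sq, h0, h1, h2,
      integral_eq_of_quartic (1 / 180) (-1 / 40) (3 / 80) (-1 / 40) (1 / 80)
        fun x => by norm_num [g]; ring]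
    norm_num
  · have h0 : p321.symm 0 = 2 := by decide
    have h1 : p321.symm 1 = 1 := by decide
    have h2 : p321.symm 2 = 0 := by decide
    rw [integral_G_sq, h0, h1, h2,
      integral_eq_of_quartic (1 / 180) (-1 / 40) (3 / 80) (-1 / 40) (1 / 80)
        fun x => by norm_num [g]; ring]
    norm_num
  · have h0 : p132.symm 0 = 0 := by decide
    have h1 : p132.symm 1 = 2 := by decide
    have h2 : p132.symm 2 = 1 := by decide
    rw [integral_G_sq, h0, h1, h2,
      integral_eq_of_quartic (1 / 180) (-1 / 24) (9 / 80) (-1 / 8) (1 / 20)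
        fun x => by norm_num [g]; ring]
    norm_num
  · have h0 : p213.symm 0 = 1 := by decide
    have h1 : p213.symm 1 = 0 := by decide
    have h2 : p213.symm 2 = 2 := by decide
    rw [integral_G_sq, h0, h1, h2,
      integral_eq_of_quartic (1 / 720) (-1 / 120) (3 / 80) (-3 / 40) (1 / 20)
        fun x => by norm_num [g]; ring]
    norm_num
  · have h0 : p231.symm 0 = 2 := by decide
    have h1 : p231.symm 1 = 0 := by decide
    have h2 : p231.symm 2 = 1 := by decide
    rw [integral_G_sq, h0, h1, h2,
      integral_eq_of_quartic (1 / 720) (-1 / 120) (3 / 80) (-3 / 40) (1 / 20)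
        fun x => by norm_num [g]; ring]
    norm_num
  · have h0 : p312.symm 0 = 1 := by decide
    have h1 : p312.symm 1 = 2 := by decide
    have h2 : p312.symm 2 = 0 := by decide
    rw [integral_G_sq, h0, h1, h2,
      integral_eq_of_quartic (1 / 180) (-1 / 24) (9 / 80) (-1 / 8) (1 / 20)
        fun x => by norm_num [g]; ring]
    norm_num
end
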